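/- arXiv:2010.00201 — 3 statements merged into one kernel-verified Lean document; each statement's English description precedes it below -/
import Mathlib

section
/- Let I ⊆ ℝ be a nonempty open interval, M ⊆ ℝⁿ an open set, and r ≥ 1. Let v : I × M → ℝⁿ be r times continuously differentiable and suppose there is a continuous function L : I → [0,∞) with ‖v(t,x₁) − v(t,x₂)‖ ≤ L(t)‖x₁ − x₂‖ for all t ∈ I and x₁, x₂ ∈ M. Assume additionally that for every (t₀,x₀) ∈ I × M the unique maximal solution of the Cauchy problem ẋ(t) = v(t,x(t)), x(t₀) = x₀ is defined on all of I (i.e., solutions cannot leave the domain I × M). Then there exists a C^r diffeomorphism Φ : I × M → I × M of the form Φ(t,x) = (t, φ(t,x)) (a time-preserving diffeomorphism) whose inverse rectifies the direction field of the equation ẋ = v(t,x): the pushforward of the vector field (t,x) ↦ (1, v(t,x)) on I × M under Φ⁻¹ is the constant vector field (t,x) ↦ (1, 0). -/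
open Set

section Flow

variable {E : Type*} [NormedAddCommGroup E] [NormedSpace ℝ E]

/-- Multiplication by a radial cutoff, equal to `1` on the ball of radius `R` and to `0` outside
the ball of radius `2 * R`, is Lipschitz. -/
theorem lipschitzWith_radialCutoff_smul {R : ℝ} (hR : 0 < R) :
    LipschitzWith 3 (fun y : E => max 0 (min 1 (2 - ‖y‖ / R)) • y) := by
  have key : ∀ x y : E, ‖x‖ ≤ ‖y‖ →
      ‖max 0 (min 1 (2 - ‖x‖ / R)) • x - max 0 (min 1 (2 - ‖y‖ / R)) • y‖ ≤ 3 * ‖x - y‖ := by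
    intro x y hxy
    set c := max 0 (min 1 (2 - ‖x‖ / R)) with hc
    set d := max 0 (min 1 (2 - ‖y‖ / R)) with hd
    have hd0 : 0 ≤ d := le_max_left _ _
    have hd1 : d ≤ 1 := max_le zero_le_one (min_le_left _ _)
    have hdiv : ‖x‖ / R ≤ ‖y‖ / R := by gcongr
    have hcd : |c - d| * ‖x‖ ≤ 2 * ‖x - y‖ := by
      rcases le_total (2 * R) ‖x‖ with h | h
      · have h2 : 2 ≤ ‖x‖ / R := by rwa [le_div_iff₀ hR]
        have hc0 : c = 0 := max_eq_left ((min_le_right _ _).trans (by linarith))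
        have hd0 : d = 0 := max_eq_left ((min_le_right _ _).trans (by linarith))
        simp [hc0, hd0]
      · have h1 : |c - d| ≤ ‖x - y‖ / R := by
          have h3 : |c - d| ≤ |(2 - ‖x‖ / R) - (2 - ‖y‖ / R)| := by
            rw [hc, hd]
            refine (abs_max_sub_max_le_max _ _ _ _).trans ?_
            rw [sub_self, abs_zero, max_eq_right (abs_nonneg _)]
            refine (abs_min_sub_min_le_max _ _ _ _).trans ?_
            rw [sub_self, abs_zero, max_eq_right (abs_nonneg _)]
          refine h3.trans ?_
          rw [show (2 - ‖x‖ / R) - (2 - ‖y‖ / R) = (‖y‖ - ‖x‖) / R by ring, abs_div,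
            abs_of_pos hR, norm_sub_rev]
          gcongr
          exact abs_norm_sub_norm_le _ _
        calc |c - d| * ‖x‖ ≤ ‖x - y‖ / R * (2 * R) := by gcongr
          _ = 2 * ‖x - y‖ := by field_simp
    calc ‖c • x - d • y‖ = ‖(c - d) • x + d • (x - y)‖ := by
          congr 1; rw [sub_smul, smul_sub]; abel
      _ ≤ |c - d| * ‖x‖ + d * ‖x - y‖ := by
          refine (norm_add_le _ _).trans ?_
          rw [norm_smul, norm_smul, Real.norm_eq_abs, Real.norm_of_nonneg hd0]
      _ ≤ 2 * ‖x - y‖ + 1 * ‖x - y‖ := by gcongr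
      _ = 3 * ‖x - y‖ := by ring
  refine LipschitzWith.of_dist_le_mul fun x y => ?_
  simp only [dist_eq_norm, NNReal.coe_ofNat]
  rcases le_total ‖x‖ ‖y‖ with h | h
  · exact key x y h
  · rw [norm_sub_rev, norm_sub_rev x]
    exact key y x h

/-- Grönwall's inequality on `[0, T]` for curves differentiable within `[0, T]`. -/
theorem norm_le_gronwallBound_of_hasDerivWithinAt_Icc {f f' : ℝ → E} {δ K ε S T : ℝ}
    (hST : S ≤ T) (hf : ∀ t ∈ Icc 0 T, HasDerivWithinAt f (f' t) (Icc 0 T) t)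
    (h0 : ‖f 0‖ ≤ δ) (bound : ∀ t ∈ Ico 0 S, ‖f' t‖ ≤ K * ‖f t‖ + ε) :
    ∀ t ∈ Icc 0 S, ‖f t‖ ≤ gronwallBound δ K ε t := by
  intro t ht
  have := norm_le_gronwallBound_of_norm_deriv_right_le (f := f) (f' := f')
    (fun s hs => ((hf s ⟨hs.1, hs.2.trans hST⟩).continuousWithinAt).mono
      (Icc_subset_Icc_right hST))
    (fun s hs => (hf s ⟨hs.1, hs.2.le.trans hST⟩).mono_of_mem_nhdsWithin
      (Filter.mem_of_superset (Icc_mem_nhdsGE (hs.2.trans_le hST)) (Icc_subset_Icc_left hs.1)))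
    h0 bound t ht
  simpa using this

theorem gronwallBound_zero_left (K ε x : ℝ) :
    gronwallBound 0 K ε x = ε * gronwallBound 0 K 1 x := by
  unfold gronwallBound
  split_ifs <;> ring

/-- Linear differential equations with continuous coefficients have solutions on the whole
interval. -/
theorem exists_hasDerivWithinAt_linear [CompleteSpace E] {T : ℝ} (hT : 0 ≤ T)
    {B : ℝ → E →L[ℝ] E} (hB : ContinuousOn B (Icc 0 T)) (y₀ : E) :
    ∃ y : ℝ → E, y 0 = y₀ ∧
      ∀ t ∈ Icc 0 T, HasDerivWithinAt y (B t (y t)) (Icc 0 T) t := by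
  obtain ⟨C, hC⟩ := isCompact_Icc.exists_bound_of_continuousOn hB
  have hC0 : 0 ≤ C := (norm_nonneg _).trans (hC 0 ⟨le_rfl, hT⟩)
  set R : ℝ := ‖y₀‖ * Real.exp (C * T) + 1 with hR
  have hRpos : 0 < R := by positivity
  set cut : E → ℝ := fun y => max 0 (min 1 (2 - ‖y‖ / R)) with hcut
  have hcut0 : ∀ y, 0 ≤ cut y := fun y => le_max_left _ _
  have hcut1 : ∀ y, cut y ≤ 1 := fun y => max_le zero_le_one (min_le_left _ _)
  have hcut_norm : ∀ y, ‖cut y • y‖ ≤ ‖y‖ := fun y => by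
    rw [norm_smul, Real.norm_of_nonneg (hcut0 y)]
    exact mul_le_of_le_one_left (norm_nonneg _) (hcut1 y)
  have hcut_bdd : ∀ y, ‖cut y • y‖ ≤ 2 * R := fun y => by
    rcases le_total ‖y‖ (2 * R) with h | h
    · exact (hcut_norm y).trans h
    · have h2 : 2 ≤ ‖y‖ / R := by rwa [le_div_iff₀ hRpos]
      have : cut y = 0 := max_eq_left ((min_le_right _ _).trans (by linarith))
      rw [this, zero_smul, norm_zero]
      positivity
  have hcut_eq : ∀ y, ‖y‖ ≤ R → cut y • y = y := fun y hy => by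
    have h2 : ‖y‖ / R ≤ 1 := by rwa [div_le_one hRpos]
    have : cut y = 1 := by
      simp only [hcut]
      rw [min_eq_left (by linarith), max_eq_right zero_le_one]
    rw [this, one_smul]
  have hPL : IsPicardLindelof (fun t y => B t (cut y • y)) (tmin := 0) (tmax := T)
      ⟨0, le_rfl, hT⟩ y₀ (C.toNNReal * (2 * R).toNNReal * T.toNNReal) 0
      (C.toNNReal * (2 * R).toNNReal) (C.toNNReal * 3) := by
    refine ⟨fun t ht => ?_, fun x _ => ?_, fun t ht x _ => ?_, ?_⟩
    · refine LipschitzWith.lipschitzOnWith (LipschitzWith.comp (f := B t) ?_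
        (lipschitzWith_radialCutoff_smul hRpos))
      refine (B t).lipschitz.weaken ?_
      rw [← NNReal.coe_le_coe, Real.coe_toNNReal _ hC0]
      exact hC t ht
    · exact hB.clm_apply continuousOn_const
    · refine ((B t).le_opNorm _).trans ?_
      rw [NNReal.coe_mul, Real.coe_toNNReal _ hC0, Real.coe_toNNReal _ (by positivity)]
      exact mul_le_mul (hC t ht) (hcut_bdd x) (norm_nonneg _) hC0
    · simp [hT]
  obtain ⟨y, hy0, hy⟩ := hPL.exists_eq_forall_mem_Icc_hasDerivWithinAt₀
  refine ⟨y, hy0, fun t ht => ?_⟩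
  have hbound := norm_le_gronwallBound_of_hasDerivWithinAt_Icc (δ := ‖y₀‖) (K := C) (ε := 0)
    le_rfl hy (by rw [← hy0]) (fun s hs => by
      rw [add_zero]
      refine ((B s).le_opNorm _).trans ?_
      exact mul_le_mul (hC s ⟨hs.1, hs.2.le⟩) (hcut_norm _) (norm_nonneg _) hC0) t ht
  rw [gronwallBound_ε0] at hbound
  have hyR : ‖y t‖ ≤ R := by
    refine hbound.trans ?_
    have : ‖y₀‖ * Real.exp (C * t) ≤ ‖y₀‖ * Real.exp (C * T) := by
      gcongr
      exact ht.2
    linarith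
  simpa only [hcut_eq _ hyR] using hy t ht

/-- A map that is strictly differentiable on an open set has continuous derivative there. -/
theorem continuousOn_of_hasStrictFDerivAt {G : Type*} [NormedAddCommGroup G] [NormedSpace ℝ G]
    {f : E → G} {f' : E → E →L[ℝ] G} {U : Set E}
    (h : ∀ x ∈ U, HasStrictFDerivAt f (f' x) x) : ContinuousOn f' U := by
  intro x₀ hx₀
  rw [Metric.continuousWithinAt_iff']
  intro ε hε
  obtain ⟨s, hs, hsx⟩ := ((h x₀ hx₀).approximates_deriv_on_nhds
    (c := (ε / 2).toNNReal) (Or.inr (by simpa using hε)))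
  obtain ⟨t, hts, ht, hxt⟩ := mem_nhds_iff.1 hs
  filter_upwards [self_mem_nhdsWithin, mem_nhdsWithin_of_mem_nhds (ht.mem_nhds hxt)] with x hx hxt
  have h1 : HasFDerivAt (f - ⇑(f' x₀)) (f' x - f' x₀) x :=
    (h x hx).hasFDerivAt.sub (f' x₀).hasFDerivAt
  have h2 := h1.le_of_lipschitzOn (Filter.mem_of_superset (ht.mem_nhds hxt) hts)
    hsx.lipschitzOnWith
  rw [dist_eq_norm]
  rw [Real.coe_toNNReal _ (by positivity)] at h2
  linarith

/-- A function continuous on an open set varies little near a compact subset, uniformly. -/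
theorem IsCompact.exists_pos_forall_ball_dist_le {X Y : Type*} [PseudoMetricSpace X]
    [PseudoMetricSpace Y] {K U : Set X}
    (hK : IsCompact K) (hU : IsOpen U) (hKU : K ⊆ U) {A : X → Y} (hA : ContinuousOn A U)
    {η : ℝ} (hη : 0 < η) :
    ∃ δ > 0, ∀ p ∈ K, ∀ q ∈ Metric.ball p δ, q ∈ U ∧ dist (A q) (A p) ≤ η := by
  obtain ⟨δ₁, hδ₁, h₁⟩ := hK.exists_thickening_subset_open hU hKU
  have h₂ := hK.uniformContinuousAt_of_continuousAt A
    (fun p hp => hA.continuousAt (hU.mem_nhds (hKU hp))) (Metric.dist_mem_uniformity hη)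
  obtain ⟨δ₂, hδ₂, h₂⟩ := Metric.mem_uniformity_dist.1 h₂
  refine ⟨min δ₁ δ₂, lt_min hδ₁ hδ₂, fun p hp q hq => ⟨h₁ ?_, ?_⟩⟩
  · exact Metric.mem_thickening_iff.2 ⟨p, hp, (Metric.mem_ball.1 hq).trans_le (min_le_left _ _)⟩
  · have := h₂ (a := p) (b := q)
      (by rw [dist_comm]; exact (Metric.mem_ball.1 hq).trans_le (min_le_right _ _)) hp
    rw [dist_comm]
    exact le_of_lt this

/-- Trajectories starting near `x₀` follow the trajectory of `x₀`, provided that the field is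
Lipschitz on a tube around that trajectory. -/
theorem forall_dist_lt_of_lipschitz_on_tube {F : E → E} {α γ : ℝ → E} {T K δ : ℝ}
    (hK : 0 ≤ K)
    (hα : ∀ t ∈ Icc 0 T, HasDerivWithinAt α (F (α t)) (Icc 0 T) t)
    (hγ : ∀ t ∈ Icc 0 T, HasDerivWithinAt γ (F (γ t)) (Icc 0 T) t)
    (hLip : ∀ t ∈ Icc 0 T, ∀ y ∈ Metric.ball (γ t) δ, ‖F y - F (γ t)‖ ≤ K * ‖y - γ t‖)
    (h0 : ‖α 0 - γ 0‖ * Real.exp (K * T) < δ) :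
    ∀ t ∈ Icc 0 T, α t ∈ Metric.ball (γ t) δ := by
  by_contra! hcon
  have hcont : ContinuousOn (fun t => dist (α t) (γ t)) (Icc 0 T) :=
    continuous_dist.comp_continuousOn (ContinuousOn.prodMk
      (fun t ht => (hα t ht).continuousWithinAt) (fun t ht => (hγ t ht).continuousWithinAt))
  have hcomp : IsCompact (Icc 0 T ∩ (fun t => dist (α t) (γ t)) ⁻¹' Ici δ) :=
    isCompact_Icc.of_isClosed_subset
      (hcont.preimage_isClosed_of_isClosed isClosed_Icc isClosed_Ici) inter_subset_left
  obtain ⟨t, ht, htδ⟩ := hcon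
  obtain ⟨S, ⟨hS, hSδ⟩, hmin⟩ := hcomp.exists_isLeast ⟨t, ht, by simpa using htδ⟩
  have hb := norm_le_gronwallBound_of_hasDerivWithinAt_Icc (δ := ‖α 0 - γ 0‖) (K := K) (ε := 0)
    hS.2 (fun t ht => (hα t ht).sub (hγ t ht)) le_rfl (fun s hs => by
      rw [add_zero]
      refine hLip s ⟨hs.1, hs.2.le.trans hS.2⟩ _ ?_
      by_contra hs'
      have := hmin ⟨⟨hs.1, hs.2.le.trans hS.2⟩, by simpa using hs'⟩
      exact absurd hs.2 (not_lt.2 this)) S ⟨hS.1, le_rfl⟩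
  rw [gronwallBound_ε0] at hb
  have h1 : ‖α 0 - γ 0‖ * Real.exp (K * S) ≤ ‖α 0 - γ 0‖ * Real.exp (K * T) := by
    gcongr
    exact hS.2
  have h2 : δ ≤ dist (α S) (γ S) := hSδ
  rw [dist_eq_norm] at h2
  exact absurd (h2.trans (hb.trans h1)) (not_le.2 h0)

/-- The flow of a `C¹` vector field is strictly differentiable in the initial point, and its
derivative is given by the solution of the variational equation. -/
theorem hasStrictFDerivAt_flow {F : E → E} {U : Set E} (hU : IsOpen U)
    (hF : ContDiffOn ℝ 1 F U) {φ : ℝ → E → E} {T : ℝ} (hT : 0 ≤ T)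
    (h0 : ∀ x ∈ U, φ 0 x = x) (hφU : ∀ x ∈ U, ∀ t ∈ Icc 0 T, φ t x ∈ U)
    (hφ : ∀ x ∈ U, ∀ t ∈ Icc 0 T, HasDerivWithinAt (fun s => φ s x) (F (φ t x)) (Icc 0 T) t)
    {x₀ : E} (hx₀ : x₀ ∈ U) {Y : ℝ → E →L[ℝ] E} (hY0 : Y 0 = ContinuousLinearMap.id ℝ E)
    (hY : ∀ t ∈ Icc 0 T,
      HasDerivWithinAt Y ((fderiv ℝ F (φ t x₀)).comp (Y t)) (Icc 0 T) t) :
    HasStrictFDerivAt (φ T) (Y T) x₀ := by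
  have hγ : ContinuousOn (fun t => φ t x₀) (Icc 0 T) :=
    fun t ht => (hφ x₀ hx₀ t ht).continuousWithinAt
  have hF' : ContinuousOn (fderiv ℝ F) U := hF.continuousOn_fderiv_of_isOpen hU le_rfl
  obtain ⟨C, hC⟩ := isCompact_Icc.exists_bound_of_continuousOn (hF'.comp hγ (hφU x₀ hx₀))
  have hC0 : 0 ≤ C := (norm_nonneg _).trans (hC 0 ⟨le_rfl, hT⟩)
  set D : ℝ := Real.exp ((C + 1) * T) * gronwallBound 0 C 1 T with hD
  have hD0 : 0 ≤ D := by
    have : gronwallBound 0 C 1 0 ≤ gronwallBound 0 C 1 T :=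
      gronwallBound_mono le_rfl zero_le_one hC0 hT
    rw [gronwallBound_x0] at this
    positivity
  rw [hasStrictFDerivAt_iff_isLittleO, Asymptotics.isLittleO_iff]
  intro c hc
  set η : ℝ := min 1 (c / (D + 1)) with hη
  have hηpos : 0 < η := by positivity
  obtain ⟨δ, hδ, htube⟩ := (isCompact_Icc.image_of_continuousOn hγ).exists_pos_forall_ball_dist_le
    hU (by rintro _ ⟨t, ht, rfl⟩; exact hφU x₀ hx₀ t ht) hF' hηpos
  have hrem : ∀ t ∈ Icc 0 T, ∀ y ∈ Metric.ball (φ t x₀) δ, ∀ z ∈ Metric.ball (φ t x₀) δ,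
      ‖F y - F z - fderiv ℝ F (φ t x₀) (y - z)‖ ≤ η * ‖y - z‖ := by
    intro t ht y hy z hz
    refine (convex_ball (φ t x₀) δ).norm_image_sub_le_of_norm_hasFDerivWithin_le'
      (f' := fderiv ℝ F) (fun w hw => ?_) (fun w hw => ?_) hz hy
    · have hwU := (htube _ (mem_image_of_mem _ ht) w hw).1
      exact ((hF.differentiableOn one_ne_zero).differentiableAt
        (hU.mem_nhds hwU)).hasFDerivAt.hasFDerivWithinAt
    · simpa only [dist_eq_norm] using (htube _ (mem_image_of_mem _ ht) w hw).2
  have hLip : ∀ t ∈ Icc 0 T, ∀ y ∈ Metric.ball (φ t x₀) δ, ∀ z ∈ Metric.ball (φ t x₀) δ,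
      ‖F y - F z‖ ≤ (C + 1) * ‖y - z‖ := by
    intro t ht y hy z hz
    calc ‖F y - F z‖ = ‖(F y - F z - fderiv ℝ F (φ t x₀) (y - z))
          + fderiv ℝ F (φ t x₀) (y - z)‖ := by rw [sub_add_cancel]
      _ ≤ η * ‖y - z‖ + C * ‖y - z‖ :=
          (norm_add_le _ _).trans (add_le_add (hrem t ht y hy z hz)
            ((fderiv ℝ F (φ t x₀)).le_of_opNorm_le (hC t ht) _))
      _ ≤ 1 * ‖y - z‖ + C * ‖y - z‖ := by gcongr; exact min_le_left _ _
      _ = (C + 1) * ‖y - z‖ := by ring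
  have hnear : ∀ᶠ x in nhds x₀, x ∈ U ∧ ‖x - x₀‖ * Real.exp ((C + 1) * T) < δ := by
    refine (hU.eventually_mem hx₀).and ?_
    have : ContinuousAt (fun x => ‖x - x₀‖ * Real.exp ((C + 1) * T)) x₀ := by fun_prop
    exact this.eventually_lt continuousAt_const (by simpa using hδ)
  have hball : ∀ x ∈ U, ‖x - x₀‖ * Real.exp ((C + 1) * T) < δ →
      ∀ t ∈ Icc 0 T, φ t x ∈ Metric.ball (φ t x₀) δ := by
    intro x hx hxδ
    refine forall_dist_lt_of_lipschitz_on_tube (by positivity) (hφ x hx) (hφ x₀ hx₀)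
      (fun t ht y hy => hLip t ht y hy _ (Metric.mem_ball_self hδ)) ?_
    rwa [h0 x hx, h0 x₀ hx₀]
  rw [nhds_prod_eq]
  filter_upwards [hnear.prod_mk hnear] with ⟨x, x'⟩ ⟨⟨hx, hxδ⟩, ⟨hx', hxδ'⟩⟩
  dsimp only at hx hxδ hx' hxδ' ⊢
  have hdist : ∀ t ∈ Icc 0 T,
      ‖φ t x - φ t x'‖ ≤ ‖x - x'‖ * Real.exp ((C + 1) * T) := by
    intro t ht
    have hb := norm_le_gronwallBound_of_hasDerivWithinAt_Icc (δ := ‖x - x'‖) (K := C + 1)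
      (ε := 0) le_rfl (fun t ht => (hφ x hx t ht).sub (hφ x' hx' t ht))
      (by simp [h0 x hx, h0 x' hx'])
      (fun s hs => by
        rw [add_zero]
        have hs' : s ∈ Icc 0 T := ⟨hs.1, hs.2.le⟩
        exact hLip s hs' _ (hball x hx hxδ s hs') _ (hball x' hx' hxδ' s hs')) t ht
    rw [gronwallBound_ε0] at hb
    refine hb.trans ?_
    gcongr
    exact ht.2
  have hz := norm_le_gronwallBound_of_hasDerivWithinAt_Icc (δ := 0) (K := C)
    (ε := η * (‖x - x'‖ * Real.exp ((C + 1) * T))) le_rfl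
    (f := fun t => φ t x - φ t x' - Y t (x - x'))
    (fun t ht => ((hφ x hx t ht).sub (hφ x' hx' t ht)).sub
      ((hY t ht).clm_apply (hasDerivWithinAt_const t _ (x - x'))))
    (by simp [h0 x hx, h0 x' hx', hY0])
    (fun s hs => by
      have hs' : s ∈ Icc 0 T := ⟨hs.1, hs.2.le⟩
      set A := fderiv ℝ F (φ s x₀)
      calc ‖F (φ s x) - F (φ s x') - ((A.comp (Y s)) (x - x') + Y s 0)‖
          = ‖A (φ s x - φ s x' - Y s (x - x')) +
              (F (φ s x) - F (φ s x') - A (φ s x - φ s x'))‖ := by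
            congr 1
            simp only [map_sub, map_zero, ContinuousLinearMap.comp_apply]
            abel
        _ ≤ C * ‖φ s x - φ s x' - Y s (x - x')‖ + η * ‖φ s x - φ s x'‖ :=
            (norm_add_le _ _).trans (add_le_add (A.le_of_opNorm_le (hC s hs') _)
              (hrem s hs' _ (hball x hx hxδ s hs') _ (hball x' hx' hxδ' s hs')))
        _ ≤ _ := by gcongr; exact hdist s hs')
    T ⟨hT, le_rfl⟩
  rw [gronwallBound_zero_left] at hz
  calc ‖φ T x - φ T x' - Y T (x - x')‖ ≤ η * D * ‖x - x'‖ := hz.trans_eq (by rw [hD]; ring)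
    _ ≤ c * ‖x - x'‖ := by
      gcongr
      calc η * D ≤ c / (D + 1) * D := by gcongr; exact min_le_right _ _
        _ ≤ c / (D + 1) * (D + 1) := by gcongr; linarith
        _ = c := by field_simp

/-- The derivatives of the flow of a `C¹` vector field in the initial point form a solution of the
variational equation. -/
theorem exists_hasStrictFDerivAt_flow [CompleteSpace E] {F : E → E} {U : Set E} (hU : IsOpen U)
    (hF : ContDiffOn ℝ 1 F U) {φ : ℝ → E → E} {T : ℝ} (hT : 0 ≤ T)
    (h0 : ∀ x ∈ U, φ 0 x = x) (hφU : ∀ x ∈ U, ∀ t ∈ Icc 0 T, φ t x ∈ U)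
    (hφ : ∀ x ∈ U, ∀ t ∈ Icc 0 T, HasDerivWithinAt (fun s => φ s x) (F (φ t x)) (Icc 0 T) t) :
    ∃ Y : E → ℝ → E →L[ℝ] E, (∀ x ∈ U, Y x 0 = ContinuousLinearMap.id ℝ E) ∧
      (∀ x ∈ U, ∀ t ∈ Icc 0 T,
        HasDerivWithinAt (Y x) ((fderiv ℝ F (φ t x)).comp (Y x t)) (Icc 0 T) t) ∧
      ∀ x ∈ U, HasStrictFDerivAt (φ T) (Y x T) x := by
  have hex : ∀ x ∈ U, ∃ Y : ℝ → E →L[ℝ] E, Y 0 = ContinuousLinearMap.id ℝ E ∧ ∀ t ∈ Icc 0 T,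
      HasDerivWithinAt Y ((fderiv ℝ F (φ t x)).comp (Y t)) (Icc 0 T) t := by
    intro x hx
    have hA : ContinuousOn (fun t => fderiv ℝ F (φ t x)) (Icc 0 T) :=
      (hF.continuousOn_fderiv_of_isOpen hU le_rfl).comp
        (fun t ht => (hφ x hx t ht).continuousWithinAt) (hφU x hx)
    exact exists_hasDerivWithinAt_linear hT
      (B := fun t => ContinuousLinearMap.compL ℝ E E E (fderiv ℝ F (φ t x)))
      ((ContinuousLinearMap.compL ℝ E E E).continuous.comp_continuousOn hA) _
  choose! Y hY0 hY using hex
  exact ⟨Y, hY0, hY, fun x hx =>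
    hasStrictFDerivAt_flow hU hF hT h0 hφU hφ hx (hY0 x hx) (hY x hx)⟩

end Flow

universe u

/-- The flow of a `C^(r+1)` vector field is `C^(r+1)` in the initial point. -/
theorem contDiffOn_flow (r : ℕ) {E : Type u} [NormedAddCommGroup E] [NormedSpace ℝ E]
    [CompleteSpace E] {F : E → E} {U : Set E} (hU : IsOpen U)
    (hF : ContDiffOn ℝ (r + 1 : ℕ) F U) {φ : ℝ → E → E} {T : ℝ} (hT : 0 ≤ T)
    (h0 : ∀ x ∈ U, φ 0 x = x) (hφU : ∀ x ∈ U, ∀ t ∈ Icc 0 T, φ t x ∈ U)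
    (hφ : ∀ x ∈ U, ∀ t ∈ Icc 0 T, HasDerivWithinAt (fun s => φ s x) (F (φ t x)) (Icc 0 T) t) :
    ContDiffOn ℝ (r + 1 : ℕ) (φ T) U := by
  induction r generalizing E with
  | zero =>
    have hF1 : ContDiffOn ℝ 1 F U := by simpa using hF
    obtain ⟨Y, -, -, hstrict⟩ := exists_hasStrictFDerivAt_flow hU hF1 hT h0 hφU hφ
    have h1 : ContDiffOn ℝ (0 + 1) (φ T) U := by
      rw [contDiffOn_succ_iff_fderiv_of_isOpen hU]
      refine ⟨fun x hx => (hstrict x hx).hasFDerivAt.differentiableAt.differentiableWithinAt,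
        by simp, ?_⟩
      rw [contDiffOn_zero]
      exact (continuousOn_of_hasStrictFDerivAt hstrict).congr
        fun x hx => (hstrict x hx).hasFDerivAt.fderiv
    simpa using h1
  | succ r ih =>
    have hF1 : ContDiffOn ℝ 1 F U := hF.of_le (by norm_cast; omega)
    obtain ⟨Y, hY0, hY, hstrict⟩ := exists_hasStrictFDerivAt_flow hU hF1 hT h0 hφU hφ
    have hF' : ContDiffOn ℝ (r + 1 : ℕ) (fderiv ℝ F) U :=
      hF.fderiv_of_isOpen hU (by norm_cast)
    have hext := ih (E := E × (E →L[ℝ] E)) (U := U ×ˢ univ)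
      (F := fun p => (F p.1, (fderiv ℝ F p.1).comp p.2))
      (φ := fun t p => (φ t p.1, (Y p.1 t).comp p.2)) (hU.prod isOpen_univ)
      (ContDiffOn.prodMk
        ((hF.of_le (by norm_cast; omega)).comp contDiffOn_fst fun p hp => hp.1)
        ((hF'.comp contDiffOn_fst fun p hp => hp.1).clm_comp contDiffOn_snd))
      (fun p hp => by simp [h0 _ hp.1, hY0 _ hp.1])
      (fun p hp t ht => ⟨hφU _ hp.1 t ht, mem_univ _⟩)
      (fun p hp t ht => by
        refine (hφ p.1 hp.1 t ht).prodMk ?_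
        have := (hY p.1 hp.1 t ht).clm_comp (hasDerivWithinAt_const t _ p.2)
        simpa [ContinuousLinearMap.comp_assoc] using this)
    have hYsmooth : ContDiffOn ℝ (r + 1 : ℕ) (fun x => Y x T) U := by
      have := contDiff_snd.comp_contDiffOn (hext.comp
        (contDiffOn_id.prodMk (contDiffOn_const (c := ContinuousLinearMap.id ℝ E)))
        (fun x hx => ⟨hx, mem_univ _⟩))
      simpa [Function.comp_def] using this
    have h1 : ContDiffOn ℝ ((r + 1 : ℕ) + 1) (φ T) U := by
      rw [contDiffOn_succ_iff_fderiv_of_isOpen hU]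
      exact ⟨fun x hx => (hstrict x hx).hasFDerivAt.differentiableAt.differentiableWithinAt,
        by simp, hYsmooth.congr fun x hx => (hstrict x hx).hasFDerivAt.fderiv⟩
    exact_mod_cast h1

/-- Solutions of `ẋ = v(t, x)` on an interval are unique if `v` is Lipschitz in the second variable
with a Lipschitz constant depending continuously on time. -/
theorem eqOn_of_hasDerivAt_of_lipschitz {E : Type*} [NormedAddCommGroup E] [NormedSpace ℝ E]
    {I : Set ℝ} (hI : I.OrdConnected) {M : Set E} {v : ℝ → E → E} {L : ℝ → ℝ}
    (hL : ContinuousOn L I)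
    (hLip : ∀ t ∈ I, ∀ x₁ ∈ M, ∀ x₂ ∈ M, ‖v t x₁ - v t x₂‖ ≤ L t * ‖x₁ - x₂‖)
    {f g : ℝ → E} (hfM : ∀ t ∈ I, f t ∈ M) (hgM : ∀ t ∈ I, g t ∈ M)
    (hf : ∀ t ∈ I, HasDerivAt f (v t (f t)) t) (hg : ∀ t ∈ I, HasDerivAt g (v t (g t)) t)
    {s : ℝ} (hs : s ∈ I) (heq : f s = g s) : EqOn f g I := by
  intro t ht
  have hLip' : ∀ a ∈ I, ∀ b ∈ I,
      ∃ K : NNReal, ∀ t ∈ Icc a b, LipschitzOnWith K (v t) M := by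
    intro a ha b hb
    obtain ⟨C, hC⟩ := isCompact_Icc.exists_bound_of_continuousOn (hL.mono (hI.out ha hb))
    refine ⟨C.toNNReal, fun t ht => LipschitzOnWith.of_dist_le_mul fun x hx y hy => ?_⟩
    rw [dist_eq_norm, dist_eq_norm]
    refine (hLip t (hI.out ha hb ht) x hx y hy).trans ?_
    gcongr
    exact (le_abs_self _).trans ((hC t ht).trans (Real.le_coe_toNNReal C))
  rcases le_total s t with h | h
  · obtain ⟨K, hK⟩ := hLip' s hs t ht
    have hss : Ico s t ⊆ I := Ico_subset_Icc_self.trans (hI.out hs ht)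
    exact ODE_solution_unique_of_mem_Icc_right (s := fun _ => M)
      (fun τ hτ => hK τ (Ico_subset_Icc_self hτ))
      (HasDerivAt.continuousOn fun τ hτ => hf τ (hI.out hs ht hτ))
      (fun τ hτ => (hf τ (hss hτ)).hasDerivWithinAt) (fun τ hτ => hfM τ (hss hτ))
      (HasDerivAt.continuousOn fun τ hτ => hg τ (hI.out hs ht hτ))
      (fun τ hτ => (hg τ (hss hτ)).hasDerivWithinAt) (fun τ hτ => hgM τ (hss hτ))
      heq ⟨h, le_rfl⟩
  · obtain ⟨K, hK⟩ := hLip' t ht s hs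
    have hss : Ioc t s ⊆ I := Ioc_subset_Icc_self.trans (hI.out ht hs)
    exact ODE_solution_unique_of_mem_Icc_left (s := fun _ => M)
      (fun τ hτ => hK τ (Ioc_subset_Icc_self hτ))
      (HasDerivAt.continuousOn fun τ hτ => hf τ (hI.out ht hs hτ))
      (fun τ hτ => (hf τ (hss hτ)).hasDerivWithinAt) (fun τ hτ => hfM τ (hss hτ))
      (HasDerivAt.continuousOn fun τ hτ => hg τ (hI.out ht hs hτ))
      (fun τ hτ => (hg τ (hss hτ)).hasDerivWithinAt) (fun τ hτ => hgM τ (hss hτ))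
      heq ⟨le_rfl, h⟩

/-- The evolution map `(a, b, x) ↦ X a b x`, sending `x` to the value at time `b` of the solution
passing through `x` at time `a`, is as smooth as the field. -/
theorem contDiffOn_evolution {E : Type u} [NormedAddCommGroup E] [NormedSpace ℝ E]
    [CompleteSpace E] {r : ℕ} (hr : 1 ≤ r) {I : Set ℝ} (hIopen : IsOpen I)
    (hIconn : I.OrdConnected) {M : Set E} (hMopen : IsOpen M) {v : ℝ → E → E}
    (hv : ContDiffOn ℝ r (fun p : ℝ × E => v p.1 p.2) (I ×ˢ M)) {X : ℝ → ℝ → E → E}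
    (hX0 : ∀ a ∈ I, ∀ x ∈ M, X a a x = x) (hXM : ∀ a ∈ I, ∀ x ∈ M, ∀ t ∈ I, X a t x ∈ M)
    (hX : ∀ a ∈ I, ∀ x ∈ M, ∀ t ∈ I, HasDerivAt (fun s => X a s x) (v t (X a t x)) t) :
    ContDiffOn ℝ r (fun p : ℝ × ℝ × E => X p.1 p.2.1 p.2.2) (I ×ˢ I ×ˢ M) := by
  obtain ⟨r, rfl⟩ : ∃ k, r = k + 1 := ⟨r - 1, by omega⟩
  -- The time change `θ ↦ a + sin² θ (b - a)` oscillates between `a` and `b`.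
  let σ : ℝ → ℝ → ℝ → ℝ := fun a b θ => a + Real.sin θ ^ 2 * (b - a)
  have hσI : ∀ a ∈ I, ∀ b ∈ I, ∀ θ, σ a b θ ∈ I := fun a ha b hb θ =>
    hIconn.convex.add_smul_sub_mem ha hb ⟨sq_nonneg _, Real.sin_sq_le_one θ⟩
  have hσ' : ∀ a b θ, HasDerivAt (σ a b) (2 * Real.sin θ * Real.cos θ * (b - a)) θ := by
    intro a b θ
    have := (((Real.hasDerivAt_sin θ).pow 2).mul_const (b - a)).const_add a
    simpa [σ] using this
  have hflow := contDiffOn_flow r (E := ℝ × ℝ × ℝ × E) (U := I ×ˢ I ×ˢ univ ×ˢ M)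
    (F := fun p => (0, 0, 1, (2 * Real.sin p.2.2.1 * Real.cos p.2.2.1 * (p.2.1 - p.1)) •
      v (σ p.1 p.2.1 p.2.2.1) p.2.2.2))
    (φ := fun s p => (p.1, p.2.1, p.2.2.1 + s,
      X (σ p.1 p.2.1 p.2.2.1) (σ p.1 p.2.1 (p.2.2.1 + s)) p.2.2.2))
    (T := Real.pi / 2)
    (hIopen.prod (hIopen.prod (isOpen_univ.prod hMopen)))
    (by
      refine contDiffOn_const.prodMk (contDiffOn_const.prodMk (contDiffOn_const.prodMk
        (ContDiffOn.smul ?_ ?_)))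
      · fun_prop
      · refine hv.comp (f := fun p : ℝ × ℝ × ℝ × E => (σ p.1 p.2.1 p.2.2.1, p.2.2.2)) ?_ ?_
        · simp only [σ]
          fun_prop
        · rintro ⟨a, b, θ, x⟩ ⟨ha, hb, -, hx⟩
          exact ⟨hσI a ha b hb θ, hx⟩)
    (by positivity)
    (by
      rintro ⟨a, b, θ, x⟩ ⟨ha, hb, -, hx⟩
      simp [hX0 _ (hσI a ha b hb θ) x hx])
    (by
      rintro ⟨a, b, θ, x⟩ ⟨ha, hb, -, hx⟩ s -
      exact ⟨ha, hb, mem_univ _, hXM _ (hσI a ha b hb θ) x hx _ (hσI a ha b hb _)⟩)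
    (by
      rintro ⟨a, b, θ, x⟩ ⟨ha, hb, -, hx⟩ s -
      refine (hasDerivWithinAt_const _ _ _).prodMk ((hasDerivWithinAt_const _ _ _).prodMk
        (HasDerivWithinAt.prodMk ((hasDerivAt_id s).const_add θ).hasDerivWithinAt ?_))
      exact (HasDerivAt.scomp s (hX _ (hσI a ha b hb θ) x hx _ (hσI a ha b hb (θ + s)))
        ((hσ' a b (θ + s)).comp_const_add θ s)).hasDerivWithinAt)
  have hproj := hflow.comp (f := fun p : ℝ × ℝ × E => (p.1, p.2.1, (0 : ℝ), p.2.2))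
    (s := I ×ˢ I ×ˢ M) (by fun_prop) (fun p hp => ⟨hp.1, hp.2.1, mem_univ _, hp.2.2⟩)
  have hlast := hproj.snd.snd.snd
  simpa [σ] using hlast

/-- **Global rectification theorem.**
Let `I ⊆ ℝ` be a nonempty open interval, `M ⊆ ℝⁿ` an open set, `r ≥ 1`, and
`v : I × M → ℝⁿ` an `r` times continuously differentiable vector field which is
Lipschitz in its second variable with a continuous Lipschitz function `L : I → [0,∞)`,
and such that every Cauchy problem `ẋ = v(t,x)`, `x(t₀) = x₀` (for `(t₀,x₀) ∈ I × M`)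
has a (unique maximal) solution defined on all of `I` staying in `M`.
Then there is a time-preserving `C^r` diffeomorphism `Φ : I × M → I × M` (with inverse `Ψ`)
whose inverse rectifies the direction field:
the pushforward under `Φ⁻¹ = Ψ` of the vector field `(t,x) ↦ (1, v(t,x))` is
the constant vector field `(1, 0)`. -/
theorem global_rectification {n : ℕ} (r : ℕ) (hr : 1 ≤ r)
    (I : Set ℝ) (hIopen : IsOpen I) (hIne : I.Nonempty) (hIconn : I.OrdConnected)
    (M : Set (EuclideanSpace ℝ (Fin n))) (hMopen : IsOpen M)
    (v : ℝ → EuclideanSpace ℝ (Fin n) → EuclideanSpace ℝ (Fin n))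
    (hv : ContDiffOn ℝ r (fun p : ℝ × EuclideanSpace ℝ (Fin n) => v p.1 p.2) (I ×ˢ M))
    (L : ℝ → ℝ) (hLcont : ContinuousOn L I) (hLnonneg : ∀ t ∈ I, 0 ≤ L t)
    (hLip : ∀ t ∈ I, ∀ x₁ ∈ M, ∀ x₂ ∈ M, ‖v t x₁ - v t x₂‖ ≤ L t * ‖x₁ - x₂‖)
    (hglobal : ∀ t₀ ∈ I, ∀ x₀ ∈ M, ∃ x : ℝ → EuclideanSpace ℝ (Fin n),
      x t₀ = x₀ ∧ (∀ t ∈ I, x t ∈ M) ∧ ∀ t ∈ I, HasDerivAt x (v t (x t)) t) :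
    ∃ Φ Ψ : ℝ × EuclideanSpace ℝ (Fin n) → ℝ × EuclideanSpace ℝ (Fin n),
      Set.MapsTo Φ (I ×ˢ M) (I ×ˢ M) ∧
      Set.MapsTo Ψ (I ×ˢ M) (I ×ˢ M) ∧
      Set.InvOn Ψ Φ (I ×ˢ M) (I ×ˢ M) ∧
      ContDiffOn ℝ r Φ (I ×ˢ M) ∧
      ContDiffOn ℝ r Ψ (I ×ˢ M) ∧
      (∀ p ∈ I ×ˢ M, (Φ p).1 = p.1) ∧
      (∀ p ∈ I ×ˢ M,
        fderiv ℝ Ψ p ((1 : ℝ), v p.1 p.2) = ((1 : ℝ), (0 : EuclideanSpace ℝ (Fin n)))) := by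
  obtain ⟨t₀, ht₀⟩ := hIne
  choose! sol hsol0 hsolM hsol using hglobal
  let X : ℝ → ℝ → EuclideanSpace ℝ (Fin n) → EuclideanSpace ℝ (Fin n) := fun a b x => sol a x b
  have hXX : ∀ a ∈ I, ∀ x ∈ M, ∀ b ∈ I, ∀ c ∈ I, X b c (X a b x) = X a c x :=
    fun a ha x hx b hb c hc => eqOn_of_hasDerivAt_of_lipschitz hIconn hLcont hLip
      (hsolM b hb _ (hsolM a ha x hx b hb)) (hsolM a ha x hx)
      (hsol b hb _ (hsolM a ha x hx b hb)) (hsol a ha x hx)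
      hb (hsol0 b hb _ (hsolM a ha x hx b hb)) hc
  have hXsmooth := contDiffOn_evolution hr hIopen hIconn hMopen hv (X := X) hsol0 hsolM hsol
  have hΨsmooth : ContDiffOn ℝ r (fun p : ℝ × EuclideanSpace ℝ (Fin n) => (p.1, X p.1 t₀ p.2))
      (I ×ˢ M) :=
    contDiffOn_fst.prodMk (hXsmooth.comp (f := fun p : ℝ × EuclideanSpace ℝ (Fin n) =>
      (p.1, t₀, p.2)) (by fun_prop) fun p hp => ⟨hp.1, ht₀, hp.2⟩)
  refine ⟨fun p => (p.1, X t₀ p.1 p.2), fun p => (p.1, X p.1 t₀ p.2),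
    fun p hp => ⟨hp.1, hsolM t₀ ht₀ _ hp.2 _ hp.1⟩,
    fun p hp => ⟨hp.1, hsolM _ hp.1 _ hp.2 _ ht₀⟩,
    ⟨fun p hp => Prod.ext rfl ?_, fun p hp => Prod.ext rfl ?_⟩,
    contDiffOn_fst.prodMk (hXsmooth.comp (f := fun p : ℝ × EuclideanSpace ℝ (Fin n) =>
      (t₀, p.1, p.2)) (by fun_prop) fun p hp => ⟨ht₀, hp.1, hp.2⟩),
    hΨsmooth, fun p _ => rfl, ?_⟩
  · exact (hXX t₀ ht₀ _ hp.2 _ hp.1 _ ht₀).trans (hsol0 t₀ ht₀ _ hp.2)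
  · exact (hXX _ hp.1 _ hp.2 _ ht₀ _ hp.1).trans (hsol0 _ hp.1 _ hp.2)
  · rintro ⟨t, x⟩ ⟨ht, hx⟩
    dsimp only at ht hx ⊢
    have hdiff := ((hΨsmooth.differentiableOn (by norm_cast; omega)).differentiableAt
      ((hIopen.prod hMopen).mem_nhds (mk_mem_prod ht hx))).hasFDerivAt
    have hcurve : HasDerivAt (fun s => (s, X t s x)) (1, v t x) t := by
      have := hsol t ht x hx t ht
      rw [hsol0 t ht x hx] at this
      exact (hasDerivAt_id t).prodMk this
    have hXt : X t t x = x := hsol0 t ht x hx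
    have hcomp := HasFDerivAt.comp_hasDerivAt_of_eq t hdiff hcurve (by rw [hXt])
    refine hcomp.unique (((hasDerivAt_id t).prodMk
      (hasDerivAt_const t (X t t₀ x))).congr_of_eventuallyEq ?_)
    filter_upwards [hIopen.mem_nhds ht] with s hs
    exact Prod.ext rfl (hXX t ht x hx s hs t₀ ht₀)
end

section
/- Let I ⊆ ℝ be a nonempty open interval, M ⊆ ℝⁿ an open set, r ≥ 1, and v : I × M → ℝⁿ be r times continuously differentiable and Lipschitz in its second variable with a continuous Lipschitz function, such that every maximal solution of every Cauchy problem for ẋ = v(t,x) is defined on all of I. Fix t₀ ∈ I and for each x₀ ∈ M let φ(·, x₀) : I → M be the unique solution with φ(t₀, x₀) = x₀. Then the map Φ : I × M → I × M, Φ(t, x₀) = (t, φ(t, x₀)), is a C^r diffeomorphism of I × M onto itself. -/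
open Set

universe u

section Estimates

variable {F : Type*} [NormedAddCommGroup F] [NormedSpace ℝ F]

/-- Derivatives within `[0, 1]` are right derivatives on `[0, 1)`. -/
lemma hasDerivWithinAt_Ici_of_Icc {f : ℝ → F} {f' : F} {s : ℝ} (hs : s ∈ Ico (0 : ℝ) 1)
    (h : HasDerivWithinAt f f' (Icc 0 1) s) : HasDerivWithinAt f f' (Ici s) s :=
  (h.mono (Icc_subset_Icc_left hs.1)).mono_of_mem_nhdsWithin (Icc_mem_nhdsGE hs.2)

/-- A Grönwall estimate on `[0, 1]` for a function vanishing at `0`. -/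
lemma norm_le_mul_exp_of_norm_deriv_le {f f' : ℝ → F} {K ε : ℝ} (hK : 1 ≤ K) (hε : 0 ≤ ε)
    (h0 : f 0 = 0) (hf : ∀ s ∈ Icc (0 : ℝ) 1, HasDerivWithinAt f (f' s) (Icc 0 1) s)
    (hbound : ∀ s ∈ Icc (0 : ℝ) 1, ‖f' s‖ ≤ K * ‖f s‖ + ε) :
    ∀ s ∈ Icc (0 : ℝ) 1, ‖f s‖ ≤ ε * Real.exp K := by
  intro s hs
  have hK0 : 0 < K := by linarith
  have h := norm_le_gronwallBound_of_norm_deriv_right_le (δ := 0) (K := K) (ε := ε)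
    (fun x hx => (hf x hx).continuousWithinAt)
    (fun x hx => hasDerivWithinAt_Ici_of_Icc hx (hf x (Ico_subset_Icc_self hx)))
    (by simp [h0]) (fun x hx => hbound x (Ico_subset_Icc_self hx)) s hs
  rw [gronwallBound_of_K_ne_0 hK0.ne'] at h
  simp only [zero_mul, zero_add, sub_zero] at h
  refine h.trans (mul_le_mul (div_le_self hε hK) ?_ ?_ hε)
  · have : Real.exp (K * s) ≤ Real.exp K := Real.exp_le_exp.2 (by nlinarith [hs.2])
    linarith
  · have : 1 ≤ Real.exp (K * s) := Real.one_le_exp (mul_nonneg hK0.le hs.1)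
    linarith

/-- A continuous function on an open set is uniformly close, near a compact subset, to its values
on that subset. -/
lemma IsCompact.exists_forall_norm_sub_le {E F : Type*} [NormedAddCommGroup E]
    [NormedAddCommGroup F] {U K : Set E} {g : E → F} (hK : IsCompact K) (hU : IsOpen U) (hKU : K ⊆ U)
    (hg : ContinuousOn g U) {ε : ℝ} (hε : 0 < ε) :
    ∃ δ > 0, ∀ p ∈ K, ∀ q, ‖q - p‖ ≤ δ → q ∈ U ∧ ‖g q - g p‖ ≤ ε := by
  obtain ⟨δ₁, hδ₁, h₁⟩ := hK.exists_cthickening_subset_open hU hKU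
  obtain ⟨δ₂, hδ₂, h₂⟩ := Metric.mem_uniformity_dist.1 <|
    hK.uniformContinuousAt_of_continuousAt g
      (fun a ha => hg.continuousAt (hU.mem_nhds (hKU ha))) (Metric.dist_mem_uniformity hε)
  refine ⟨min δ₁ (δ₂ / 2), by positivity, fun p hp q hq => ⟨h₁ ?_, ?_⟩⟩
  · exact Metric.mem_cthickening_of_dist_le q p δ₁ K hp
      (by rw [dist_eq_norm]; exact hq.trans (min_le_left _ _))
  · have hpq : dist p q < δ₂ := by
      rw [dist_comm, dist_eq_norm]
      linarith [hq.trans (min_le_right _ _)]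
    have := h₂ hpq hp
    simp only [mem_ofPred_eq] at this
    rw [dist_comm, dist_eq_norm] at this
    exact this.le

/-- Near a compact set, a `C¹` map is uniformly approximated by its first order expansions. -/
lemma IsCompact.exists_forall_norm_sub_fderiv_le {E : Type*} [NormedAddCommGroup E]
    [NormedSpace ℝ E] {U K : Set E} {g : E → F} (hK : IsCompact K) (hU : IsOpen U) (hKU : K ⊆ U)
    (hg : ContDiffOn ℝ 1 g U) {ε : ℝ} (hε : 0 < ε) :
    ∃ δ > 0, ∀ p ∈ K, ∀ q, ‖q - p‖ ≤ δ →
      ‖fderiv ℝ g q - fderiv ℝ g p‖ ≤ ε ∧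
      ‖g q - g p - fderiv ℝ g p (q - p)‖ ≤ ε * ‖q - p‖ := by
  obtain ⟨δ, hδ, h⟩ := hK.exists_forall_norm_sub_le hU hKU
    (hg.continuousOn_fderiv_of_isOpen hU le_rfl) hε
  refine ⟨δ, hδ, fun p hp q hq => ⟨(h p hp q hq).2, ?_⟩⟩
  refine (convex_closedBall p δ).norm_image_sub_le_of_norm_hasFDerivWithin_le'
    (f' := fderiv ℝ g) (fun x hx => ?_) (fun x hx => (h p hp x (mem_closedBall_iff_norm.1 hx)).2)
    (Metric.mem_closedBall_self hδ.le) (mem_closedBall_iff_norm.2 hq)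
  have hx' := (h p hp x (mem_closedBall_iff_norm.1 hx)).1
  exact ((hg.differentiableOn one_ne_zero).differentiableAt
    (hU.mem_nhds hx')).hasFDerivAt.hasFDerivWithinAt

end Estimates

section LinearEquation

open scoped Nat

variable {R : Type*} [NormedRing R] [NormedAlgebra ℝ R]

/-- The terms of the Dyson series of the linear equation `X' = A X`, `X(0) = 1`. -/
noncomputable def dysonTerm (A : ℝ → R) : ℕ → ℝ → R
  | 0 => fun _ => 1
  | n + 1 => fun t => ∫ s in (0 : ℝ)..t, A s * dysonTerm A n s

lemma continuous_dysonTerm [CompleteSpace R] {A : ℝ → R} (hA : Continuous A) (n : ℕ) :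
    Continuous (dysonTerm A n) := by
  induction n with
  | zero => exact continuous_const
  | succ n ih =>
    exact intervalIntegral.continuous_primitive
      (fun a b => (hA.mul ih).intervalIntegrable a b) 0

lemma norm_dysonTerm_le {A : ℝ → R} {K : ℝ} (hK : ∀ s, ‖A s‖ ≤ K)
    (n : ℕ) (t : ℝ) : ‖dysonTerm A n t‖ ≤ ‖(1 : R)‖ * ((K * |t|) ^ n / n !) := by
  have hK0 : 0 ≤ K := (norm_nonneg _).trans (hK 0)
  induction n generalizing t with
  | zero => simp [dysonTerm]
  | succ n ih =>
    calc ‖dysonTerm A (n + 1) t‖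
        ≤ ∫ s in uIoc 0 t, ‖(1 : R)‖ * (K ^ (n + 1) / n !) * |s - 0| ^ n := by
          rw [dysonTerm, intervalIntegral.norm_intervalIntegral_eq]
          refine MeasureTheory.norm_integral_le_of_norm_le
            (Continuous.integrableOn_uIoc (by fun_prop)) (.of_forall fun s => ?_)
          calc ‖A s * dysonTerm A n s‖ ≤ K * (‖(1 : R)‖ * ((K * |s|) ^ n / n !)) :=
                (norm_mul_le _ _).trans (mul_le_mul (hK s) (ih s) (norm_nonneg _) hK0)
            _ = _ := by rw [sub_zero, mul_pow]; ring
      _ = ‖(1 : R)‖ * ((K * |t|) ^ (n + 1) / (n + 1)!) := by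
          rw [MeasureTheory.integral_const_mul, integral_pow_abs_sub_uIoc, sub_zero,
            Nat.factorial_succ, mul_pow]
          push_cast
          field_simp

/-- A linear equation with continuous coefficients on `[0, 1]` has a fundamental solution. -/
lemma exists_fundamental_solution [CompleteSpace R] {A : ℝ → R}
    (hA : ContinuousOn A (Icc 0 1)) :
    ∃ X : ℝ → R, X 0 = 1 ∧
      ∀ s ∈ Icc (0 : ℝ) 1, HasDerivWithinAt X (A s * X s) (Icc 0 1) s := by
  set A' : ℝ → R := IccExtend zero_le_one ((Icc (0 : ℝ) 1).domRestrict A)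
  have hAc : Continuous A' := (continuousOn_iff_continuous_domRestrict.1 hA).Icc_extend'
  have hAA' : ∀ s ∈ Icc (0 : ℝ) 1, A' s = A s := fun s hs => IccExtend_of_mem _ _ hs
  obtain ⟨K, hK⟩ := isCompact_Icc.exists_bound_of_continuousOn hA
  have hK' : ∀ s, ‖A' s‖ ≤ K := fun s => hK _ (projIcc (0 : ℝ) 1 zero_le_one s).2
  have hK0 : 0 ≤ K := (norm_nonneg _).trans (hK' 0)
  have hsum : Summable fun n : ℕ => ‖(1 : R)‖ * ((K * 2) ^ n / n !) :=
    (Real.summable_pow_div_factorial _).mul_left _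
  have hle : ∀ n, ∀ t ∈ Ioo (-2 : ℝ) 2,
      ‖dysonTerm A' n t‖ ≤ ‖(1 : R)‖ * ((K * 2) ^ n / n !) := fun n t ht =>
    (norm_dysonTerm_le hK' n t).trans (by
      have := abs_le.2 ⟨ht.1.le, ht.2.le⟩
      gcongr)
  have hderiv : ∀ n, ∀ t ∈ Ioo (-2 : ℝ) 2,
      HasDerivAt (dysonTerm A' (n + 1)) (A' t * dysonTerm A' n t) t := fun n t _ =>
    intervalIntegral.integral_hasDerivAt_right
      ((hAc.mul (continuous_dysonTerm hAc n)).intervalIntegrable _ _)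
      (hAc.mul (continuous_dysonTerm hAc n)).aestronglyMeasurable.stronglyMeasurableAtFilter
      (hAc.mul (continuous_dysonTerm hAc n)).continuousAt
  have hzero : ∀ n, dysonTerm A' (n + 1) 0 = 0 := fun n => by simp [dysonTerm]
  have hX : ∀ t ∈ Ioo (-2 : ℝ) 2, Summable fun n => dysonTerm A' n t := fun t ht =>
    Summable.of_norm_bounded hsum fun n => hle n t ht
  refine ⟨fun t => 1 + ∑' n, dysonTerm A' (n + 1) t, by simp [hzero], fun s hs => ?_⟩
  have hs' : s ∈ Ioo (-2 : ℝ) 2 := ⟨by linarith [hs.1], by linarith [hs.2]⟩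
  have h := hasDerivAt_tsum_of_isPreconnected (hsum.mul_left K) isOpen_Ioo isPreconnected_Ioo
    hderiv (fun n t ht => (norm_mul_le _ _).trans
      (mul_le_mul (hK' t) (hle n t ht) (norm_nonneg _) hK0))
    (y₀ := 0) (by norm_num) (by simp [hzero]) hs'
  have heq : ∑' n, A' s * dysonTerm A' n s = A s * (1 + ∑' n, dysonTerm A' (n + 1) s) := by
    rw [(hX s hs').tsum_mul_left, (hX s hs').tsum_eq_zero_add, hAA' s hs]
    rfl
  rw [heq] at h
  exact (h.const_add 1).hasDerivWithinAt

end LinearEquation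

section UnitTimeFlow

/-- `θ` is a flow on the time interval `[0, 1]` of the autonomous equation `ẋ = w(x)` in `U`, with
initial conditions in `Ω`. -/
structure IsUnitTimeFlow {E : Type*} [NormedAddCommGroup E] [NormedSpace ℝ E]
    (w : E → E) (U Ω : Set E) (θ : ℝ → E → E) : Prop where
  initial : ∀ p ∈ Ω, θ 0 p = p
  mem : ∀ p ∈ Ω, ∀ s ∈ Icc (0 : ℝ) 1, θ s p ∈ U
  hasDerivWithinAt : ∀ p ∈ Ω, ∀ s ∈ Icc (0 : ℝ) 1,
    HasDerivWithinAt (fun s => θ s p) (w (θ s p)) (Icc 0 1) s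

namespace IsUnitTimeFlow

variable {E : Type u} [NormedAddCommGroup E] [NormedSpace ℝ E]
  {w : E → E} {U Ω : Set E} {θ : ℝ → E → E}

lemma continuousOn (h : IsUnitTimeFlow w U Ω θ) {p : E} (hp : p ∈ Ω) :
    ContinuousOn (fun s => θ s p) (Icc 0 1) :=
  fun s hs => (h.hasDerivWithinAt p hp s hs).continuousWithinAt

/-- The orbit of `p` during the time interval `[0, 1]` is compact. -/
lemma isCompact_orbit (h : IsUnitTimeFlow w U Ω θ) {p : E} (hp : p ∈ Ω) :
    IsCompact ((fun s => θ s p) '' Icc (0 : ℝ) 1) :=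
  isCompact_Icc.image_of_continuousOn (h.continuousOn hp)

lemma orbit_subset (h : IsUnitTimeFlow w U Ω θ) {p : E} (hp : p ∈ Ω) :
    (fun s => θ s p) '' Icc (0 : ℝ) 1 ⊆ U :=
  image_subset_iff.2 (h.mem p hp)

lemma continuousOn_fderiv (h : IsUnitTimeFlow w U Ω θ) (hU : IsOpen U)
    (hw : ContDiffOn ℝ 1 w U) {p : E} (hp : p ∈ Ω) :
    ContinuousOn (fun s => fderiv ℝ w (θ s p)) (Icc 0 1) :=
  (hw.continuousOn_fderiv_of_isOpen hU le_rfl).comp (h.continuousOn hp) (h.mem p hp)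

lemma exists_fderiv_bound (h : IsUnitTimeFlow w U Ω θ) (hU : IsOpen U)
    (hw : ContDiffOn ℝ 1 w U) {p : E} (hp : p ∈ Ω) :
    ∃ K, 1 ≤ K ∧ ∀ s ∈ Icc (0 : ℝ) 1, ‖fderiv ℝ w (θ s p)‖ ≤ K := by
  obtain ⟨K, hK⟩ := isCompact_Icc.exists_bound_of_continuousOn (h.continuousOn_fderiv hU hw hp)
  exact ⟨max K 1, le_max_right _ _, fun s hs => (hK s hs).trans (le_max_left _ _)⟩

/-- The flow is locally Lipschitz in the initial condition, uniformly in time. -/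
lemma exists_norm_sub_le (h : IsUnitTimeFlow w U Ω θ) (hU : IsOpen U) (hΩ : IsOpen Ω)
    (hw : ContDiffOn ℝ 1 w U) {p : E} (hp : p ∈ Ω) :
    ∃ C > 0, ∃ δ > 0, ∀ q, ‖q - p‖ ≤ δ → q ∈ Ω ∧
      ∀ s ∈ Icc (0 : ℝ) 1, ‖θ s q - θ s p‖ ≤ C * ‖q - p‖ := by
  obtain ⟨K, hK1, hK⟩ := h.exists_fderiv_bound hU hw hp
  obtain ⟨δ₁, hδ₁, h₁⟩ := (h.isCompact_orbit hp).exists_forall_norm_sub_fderiv_le hU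
    (h.orbit_subset hp) hw one_pos
  obtain ⟨δ₂, hδ₂, h₂⟩ := Metric.isOpen_iff.1 hΩ p hp
  set C := Real.exp (K + 2)
  have hC0 : 0 < C := Real.exp_pos _
  refine ⟨C, hC0, min (δ₁ / C) (δ₂ / 2), by positivity, fun q hq => ?_⟩
  have hqΩ : q ∈ Ω := h₂ (by
    rw [Metric.mem_ball, dist_eq_norm]; linarith [hq.trans (min_le_right _ _)])
  refine ⟨hqΩ, fun s hs => ?_⟩
  rcases eq_or_ne q p with rfl | hqp
  · simp
  have hd : 0 < ‖q - p‖ := norm_pos_iff.2 (sub_ne_zero.2 hqp)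
  have hdδ : ‖q - p‖ * C ≤ δ₁ := (le_div_iff₀ hC0).1 (hq.trans (min_le_left _ _))
  have hexp : ∀ x ∈ Icc (0 : ℝ) 1, Real.exp ((K + 2) * x) ≤ C := fun x hx =>
    Real.exp_le_exp.2 (by nlinarith [hx.2])
  have hB : ∀ x, HasDerivAt (fun x => ‖q - p‖ * Real.exp ((K + 2) * x))
      ((K + 2) * (‖q - p‖ * Real.exp ((K + 2) * x))) x := fun x => by
    exact (((hasDerivAt_id' x).const_mul (K + 2)).exp.const_mul ‖q - p‖).congr_deriv (by ring)
  have key := image_norm_le_of_norm_deriv_right_lt_deriv_boundary'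
    (f := fun x => θ x q - θ x p) (f' := fun x => w (θ x q) - w (θ x p)) (a := 0) (b := 1)
    (fun x hx => ((h.continuousOn hqΩ).sub (h.continuousOn hp)) x hx)
    (fun x hx => hasDerivWithinAt_Ici_of_Icc hx
      ((h.hasDerivWithinAt q hqΩ x (Ico_subset_Icc_self hx)).sub
        (h.hasDerivWithinAt p hp x (Ico_subset_Icc_self hx))))
    (B := fun x => ‖q - p‖ * Real.exp ((K + 2) * x))
    (by simp [h.initial q hqΩ, h.initial p hp])
    (fun x _ => (hB x).continuousAt.continuousWithinAt)
    (fun x _ => (hB x).hasDerivWithinAt)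
    (fun x hx heq => by
      have hx' := Ico_subset_Icc_self hx
      have hpos : 0 < ‖q - p‖ * Real.exp ((K + 2) * x) := mul_pos hd (Real.exp_pos _)
      have hle : ‖θ x q - θ x p‖ ≤ δ₁ := by
        rw [heq]
        exact (mul_le_mul_of_nonneg_left (hexp x hx') hd.le).trans hdδ
      have h₃ := (h₁ _ (mem_image_of_mem _ hx') _ hle).2
      have h₄ := (fderiv ℝ w (θ x p)).le_of_opNorm_le (hK x hx') (θ x q - θ x p)
      have h₅ := norm_le_norm_sub_add (w (θ x q) - w (θ x p))
        (fderiv ℝ w (θ x p) (θ x q - θ x p))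
      rw [← heq] at hpos ⊢
      linarith) hs
  calc ‖θ s q - θ s p‖ ≤ ‖q - p‖ * Real.exp ((K + 2) * s) := key
    _ ≤ ‖q - p‖ * C := mul_le_mul_of_nonneg_left (hexp s hs) hd.le
    _ = C * ‖q - p‖ := mul_comm _ _

/-- A solution of the variational equation is the derivative of the flow. -/
lemma hasFDerivAt (h : IsUnitTimeFlow w U Ω θ) (hU : IsOpen U) (hΩ : IsOpen Ω)
    (hw : ContDiffOn ℝ 1 w U) {p : E} (hp : p ∈ Ω) {W : ℝ → E →L[ℝ] E} (hW0 : W 0 = 1)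
    (hW : ∀ s ∈ Icc (0 : ℝ) 1,
      HasDerivWithinAt W (fderiv ℝ w (θ s p) * W s) (Icc 0 1) s)
    {s : ℝ} (hs : s ∈ Icc (0 : ℝ) 1) : HasFDerivAt (θ s) (W s) p := by
  obtain ⟨K, hK1, hK⟩ := h.exists_fderiv_bound hU hw hp
  obtain ⟨C, hC, δ₁, hδ₁, h₁⟩ := h.exists_norm_sub_le hU hΩ hw hp
  rw [hasFDerivAt_iff_isLittleO, Asymptotics.isLittleO_iff]
  intro c hc
  have hε : 0 < c / (C * Real.exp K) := by positivity
  obtain ⟨δ₂, hδ₂, h₂⟩ := (h.isCompact_orbit hp).exists_forall_norm_sub_fderiv_le hU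
    (h.orbit_subset hp) hw hε
  have hδ : 0 < min δ₁ (δ₂ / C) := by positivity
  filter_upwards [Metric.closedBall_mem_nhds p hδ] with q hq
  rw [mem_closedBall_iff_norm] at hq
  obtain ⟨hqΩ, hq₁⟩ := h₁ q (hq.trans (min_le_left _ _))
  have hq₂ : C * ‖q - p‖ ≤ δ₂ := by
    rw [mul_comm]
    exact (le_div_iff₀ hC).1 (hq.trans (min_le_right _ _))
  have key := norm_le_mul_exp_of_norm_deriv_le
    (f := fun x => θ x q - θ x p - W x (q - p))
    (f' := fun x => w (θ x q) - w (θ x p) - (fderiv ℝ w (θ x p) * W x) (q - p))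
    (K := K) (ε := c / (C * Real.exp K) * (C * ‖q - p‖)) hK1 (by positivity)
    (by simp [h.initial q hqΩ, h.initial p hp, hW0])
    (fun x hx => ((h.hasDerivWithinAt q hqΩ x hx).sub (h.hasDerivWithinAt p hp x hx)).sub
      ((ContinuousLinearMap.apply ℝ E (q - p)).hasFDerivAt.comp_hasDerivWithinAt x (hW x hx)))
    (fun x hx => by
      have h₃ := (h₂ _ (mem_image_of_mem _ hx) _ ((hq₁ x hx).trans hq₂)).2
      have h₄ := (fderiv ℝ w (θ x p)).le_of_opNorm_le (hK x hx)
        (θ x q - θ x p - W x (q - p))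
      have h₅ : w (θ x q) - w (θ x p) - (fderiv ℝ w (θ x p) * W x) (q - p) =
          fderiv ℝ w (θ x p) (θ x q - θ x p - W x (q - p)) +
          (w (θ x q) - w (θ x p) - fderiv ℝ w (θ x p) (θ x q - θ x p)) := by
        rw [map_sub _ (θ x q - θ x p), mul_apply_eq_comp]
        abel
      rw [h₅]
      refine (norm_add_le _ _).trans (add_le_add h₄ (h₃.trans ?_))
      exact mul_le_mul_of_nonneg_left (hq₁ x hx) hε.le) s hs
  refine key.trans_eq ?_
  field_simp

variable [CompleteSpace E]

/-- The flow of a `C¹` vector field is differentiable, and its derivative solves the variational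
equation. -/
lemma exists_hasFDerivAt (h : IsUnitTimeFlow w U Ω θ) (hU : IsOpen U) (hΩ : IsOpen Ω)
    (hw : ContDiffOn ℝ 1 w U) {p : E} (hp : p ∈ Ω) :
    fderiv ℝ (θ 0) p = 1 ∧ ∀ s ∈ Icc (0 : ℝ) 1, DifferentiableAt ℝ (θ s) p ∧
      HasDerivWithinAt (fun s => fderiv ℝ (θ s) p)
        (fderiv ℝ w (θ s p) * fderiv ℝ (θ s) p) (Icc 0 1) s := by
  obtain ⟨W, hW0, hW⟩ := exists_fundamental_solution (h.continuousOn_fderiv hU hw hp)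
  have hθW : ∀ s ∈ Icc (0 : ℝ) 1, HasFDerivAt (θ s) (W s) p := fun s hs =>
    h.hasFDerivAt hU hΩ hw hp hW0 hW hs
  refine ⟨by rw [(hθW 0 (by simp)).fderiv, hW0], fun s hs => ⟨(hθW s hs).differentiableAt, ?_⟩⟩
  rw [(hθW s hs).fderiv]
  exact (hW s hs).congr (fun x hx => (hθW x hx).fderiv) (hθW s hs).fderiv

/-- The derivative of the flow of a `C¹` vector field is continuous. -/
lemma continuousOn_fderiv_flow (h : IsUnitTimeFlow w U Ω θ) (hU : IsOpen U) (hΩ : IsOpen Ω)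
    (hw : ContDiffOn ℝ 1 w U) {s : ℝ} (hs : s ∈ Icc (0 : ℝ) 1) :
    ContinuousOn (fderiv ℝ (θ s)) Ω := by
  intro p hp
  refine ContinuousAt.continuousWithinAt ?_
  obtain ⟨K, hK1, hK⟩ := h.exists_fderiv_bound hU hw hp
  obtain ⟨C, hC, δ₁, hδ₁, h₁⟩ := h.exists_norm_sub_le hU hΩ hw hp
  have hW := h.exists_hasFDerivAt hU hΩ hw hp
  obtain ⟨B, hB⟩ := isCompact_Icc.exists_bound_of_continuousOn
    (fun s hs => (hW.2 s hs).2.continuousWithinAt)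
  have hB0 : 0 ≤ B := (norm_nonneg _).trans (hB s hs)
  rw [Metric.continuousAt_iff']
  intro c hc
  set ε := min 1 (c / (2 * (B + 1) * Real.exp (K + 1)))
  have hε : 0 < ε := by positivity
  obtain ⟨δ₂, hδ₂, h₂⟩ := (h.isCompact_orbit hp).exists_forall_norm_sub_fderiv_le hU
    (h.orbit_subset hp) hw hε
  have hδ : 0 < min δ₁ (δ₂ / C) := by positivity
  filter_upwards [Metric.closedBall_mem_nhds p hδ] with q hq
  rw [mem_closedBall_iff_norm] at hq
  obtain ⟨hqΩ, hq₁⟩ := h₁ q (hq.trans (min_le_left _ _))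
  have hq₂ : C * ‖q - p‖ ≤ δ₂ := by
    rw [mul_comm]
    exact (le_div_iff₀ hC).1 (hq.trans (min_le_right _ _))
  have hV := h.exists_hasFDerivAt hU hΩ hw hqΩ
  have key := norm_le_mul_exp_of_norm_deriv_le
    (f := fun x => fderiv ℝ (θ x) q - fderiv ℝ (θ x) p)
    (f' := fun x => fderiv ℝ w (θ x q) * fderiv ℝ (θ x) q -
      fderiv ℝ w (θ x p) * fderiv ℝ (θ x) p)
    (K := K + 1) (ε := ε * B) (by linarith) (by positivity)
    (by simp [hV.1, hW.1])
    (fun x hx => (hV.2 x hx).2.sub (hW.2 x hx).2)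
    (fun x hx => by
      have h₃ := (h₂ _ (mem_image_of_mem _ hx) _ ((hq₁ x hx).trans hq₂)).1
      have h₄ : ‖fderiv ℝ w (θ x q)‖ ≤ K + 1 := by
        have := norm_le_norm_sub_add (fderiv ℝ w (θ x q)) (fderiv ℝ w (θ x p))
        have := hK x hx
        have : ε ≤ 1 := min_le_left _ _
        linarith
      have h₅ : fderiv ℝ w (θ x q) * fderiv ℝ (θ x) q - fderiv ℝ w (θ x p) * fderiv ℝ (θ x) p =
          fderiv ℝ w (θ x q) * (fderiv ℝ (θ x) q - fderiv ℝ (θ x) p) +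
          (fderiv ℝ w (θ x q) - fderiv ℝ w (θ x p)) * fderiv ℝ (θ x) p := by
        noncomm_ring
      rw [h₅]
      refine (norm_add_le _ _).trans (add_le_add ?_ ?_)
      · exact (norm_mul_le _ _).trans (mul_le_mul_of_nonneg_right h₄ (norm_nonneg _))
      · exact (norm_mul_le _ _).trans (mul_le_mul h₃ (hB x hx) (norm_nonneg _) hε.le)) s hs
  rw [dist_eq_norm]
  refine key.trans_lt ?_
  have hεc : ε * (2 * (B + 1) * Real.exp (K + 1)) ≤ c :=
    (le_div_iff₀ (by positivity)).1 (min_le_right _ _)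
  have : 0 < ε * Real.exp (K + 1) := by positivity
  nlinarith

/-- The flow of a vector field, coupled with its variational equation, is a flow. -/
lemma variational (h : IsUnitTimeFlow w U Ω θ) (hU : IsOpen U) (hΩ : IsOpen Ω)
    (hw : ContDiffOn ℝ 1 w U) :
    IsUnitTimeFlow (fun z : E × (E →L[ℝ] E) => (w z.1, fderiv ℝ w z.1 * z.2))
      (U ×ˢ univ) (Ω ×ˢ univ) (fun s z => (θ s z.1, fderiv ℝ (θ s) z.1 * z.2)) where
  initial := by
    rintro ⟨p, V⟩ ⟨hp, -⟩
    simp only [h.initial p hp, (h.exists_hasFDerivAt hU hΩ hw hp).1, one_mul]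
  mem z hz s hs := ⟨h.mem z.1 hz.1 s hs, mem_univ _⟩
  hasDerivWithinAt z hz s hs := by
    refine (h.hasDerivWithinAt z.1 hz.1 s hs).prodMk ?_
    rw [← mul_assoc]
    exact ((h.exists_hasFDerivAt hU hΩ hw hz.1).2 s hs).2.mul_const z.2

end IsUnitTimeFlow

/-- The flow of a `C^r` vector field, `r ≥ 1`, is `C^r` in the initial condition. -/
theorem IsUnitTimeFlow.contDiffOn (r : ℕ) : ∀ {E : Type u} [NormedAddCommGroup E] [NormedSpace ℝ E]
    [CompleteSpace E] {w : E → E} {U Ω : Set E} {θ : ℝ → E → E}, IsUnitTimeFlow w U Ω θ →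
    IsOpen U → IsOpen Ω → ContDiffOn ℝ (r + 1 : ℕ) w U → ∀ s ∈ Icc (0 : ℝ) 1,
    ContDiffOn ℝ (r + 1 : ℕ) (θ s) Ω := by
  induction r with
  | zero =>
    intro E _ _ _ w U Ω θ h hU hΩ hw s hs
    have hw1 : ContDiffOn ℝ 1 w U := by simpa using hw
    rw [Nat.cast_succ]
    refine (contDiffOn_succ_iff_fderiv_of_isOpen hΩ).2 ⟨fun p hp =>
      ((h.exists_hasFDerivAt hU hΩ hw1 hp).2 s hs).1.differentiableWithinAt, fun hω =>
        absurd hω (WithTop.natCast_ne_top _), ?_⟩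
    rw [Nat.cast_zero, contDiffOn_zero]
    exact (h.continuousOn_fderiv_flow hU hΩ hw1 hs)
  | succ r ih =>
    intro E _ _ _ w U Ω θ h hU hΩ hw s hs
    have hw1 : ContDiffOn ℝ 1 w U := hw.of_le (by exact_mod_cast Nat.succ_le_succ (Nat.zero_le _))
    rw [Nat.cast_succ] at hw ⊢
    refine (contDiffOn_succ_iff_fderiv_of_isOpen hΩ).2 ⟨fun p hp =>
      ((h.exists_hasFDerivAt hU hΩ hw1 hp).2 s hs).1.differentiableWithinAt, fun hω =>
        absurd hω (WithTop.natCast_ne_top _), ?_⟩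
    have hfst : MapsTo Prod.fst (U ×ˢ (univ : Set (E →L[ℝ] E))) U := fun z hz => hz.1
    have hflow := ih (h.variational hU hΩ hw1) (hU.prod isOpen_univ) (hΩ.prod isOpen_univ)
      (((hw.of_le le_self_add).comp contDiffOn_fst hfst).prodMk
        (((hw.fderiv_of_isOpen hU le_rfl).comp contDiffOn_fst hfst).mul contDiffOn_snd)) s hs
    have hcomp := contDiff_snd.comp_contDiffOn (hflow.comp
      (contDiffOn_id.prodMk (contDiffOn_const (c := (1 : E →L[ℝ] E))))
      (fun p hp => ⟨hp, mem_univ _⟩))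
    exact hcomp.congr fun p _ => (mul_one _).symm

end UnitTimeFlow

section NonautonomousFlow

variable {E : Type*} [NormedAddCommGroup E] [NormedSpace ℝ E]
  {I : Set ℝ} {M : Set E} {v : ℝ → E → E}

/-- Uniqueness of solutions on an open interval for a vector field which is Lipschitz in space,
with a Lipschitz constant depending continuously on time. -/
lemma solution_unique_of_continuousOn_lipschitz (hIopen : IsOpen I) (hIconn : I.OrdConnected)
    {L : ℝ → ℝ} (hL : ContinuousOn L I)
    (hLip : ∀ t ∈ I, ∀ x₁ ∈ M, ∀ x₂ ∈ M, ‖v t x₁ - v t x₂‖ ≤ L t * ‖x₁ - x₂‖)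
    {x y : ℝ → E} (hxM : ∀ t ∈ I, x t ∈ M) (hx : ∀ t ∈ I, HasDerivAt x (v t (x t)) t)
    (hyM : ∀ t ∈ I, y t ∈ M) (hy : ∀ t ∈ I, HasDerivAt y (v t (y t)) t)
    {t₁ : ℝ} (ht₁ : t₁ ∈ I) (heq : x t₁ = y t₁) : EqOn x y I := by
  intro t ht
  have hmin : min t₁ t ∈ I := by rcases min_choice t₁ t with h | h <;> rwa [h]
  have hmax : max t₁ t ∈ I := by rcases max_choice t₁ t with h | h <;> rwa [h]
  obtain ⟨a, ha, haI⟩ := exists_Ioc_subset_of_mem_nhds (hIopen.mem_nhds hmin) (exists_lt _)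
  obtain ⟨b, hb, hbI⟩ := exists_Ico_subset_of_mem_nhds (hIopen.mem_nhds hmax) (exists_gt _)
  obtain ⟨c, hac, hcm⟩ := exists_between ha
  obtain ⟨d, hmd, hdb⟩ := exists_between hb
  have hsub : Icc c d ⊆ I := hIconn.out (haI ⟨hac, hcm.le⟩) (hbI ⟨hmd.le, hdb⟩)
  obtain ⟨K, hK⟩ := isCompact_Icc.exists_bound_of_continuousOn (hL.mono hsub)
  have hIoo : ∀ s ∈ Ioo c d, s ∈ I := fun s hs => hsub (Ioo_subset_Icc_self hs)
  refine ODE_solution_unique_of_mem_Ioo (v := v) (s := fun _ => M) (K := K.toNNReal)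
    (a := c) (b := d) (t₀ := t₁) (fun s hs => ?_) ?_
    (fun s hs => ⟨hx s (hIoo s hs), hxM s (hIoo s hs)⟩)
    (fun s hs => ⟨hy s (hIoo s hs), hyM s (hIoo s hs)⟩) heq ?_
  · refine LipschitzOnWith.of_dist_le_mul fun x₁ h₁ x₂ h₂ => ?_
    rw [dist_eq_norm, dist_eq_norm]
    refine (hLip s (hIoo s hs) x₁ h₁ x₂ h₂).trans (mul_le_mul_of_nonneg_right ?_ (norm_nonneg _))
    exact (le_abs_self _).trans ((hK s (Ioo_subset_Icc_self hs)).trans (Real.le_coe_toNNReal K))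
  · exact ⟨hcm.trans_le (min_le_left _ _), (le_max_left _ _).trans_lt hmd⟩
  · exact ⟨hcm.trans_le (min_le_right _ _), (le_max_right _ _).trans_lt hmd⟩

/-- Global solutions of `ẋ = v(t, x)`, rescaled to the time interval `[0, 1]`, form a flow of an
autonomous equation whose state consists of the time, the duration and the position. -/
lemma isUnitTimeFlow_of_solution (hIconn : I.OrdConnected) {X : ℝ → E → ℝ → E}
    (hX₀ : ∀ τ ∈ I, ∀ x ∈ M, X τ x τ = x) (hXM : ∀ τ ∈ I, ∀ x ∈ M, ∀ t ∈ I, X τ x t ∈ M)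
    (hX : ∀ τ ∈ I, ∀ x ∈ M, ∀ t ∈ I, HasDerivAt (X τ x) (v t (X τ x t)) t) :
    IsUnitTimeFlow (fun z : ℝ × ℝ × E => (z.2.1, (0 : ℝ), z.2.1 • v z.1 z.2.2))
      (I ×ˢ univ ×ˢ M) {z | z.1 ∈ I ∧ z.1 + z.2.1 ∈ I ∧ z.2.2 ∈ M}
      (fun s z => (z.1 + s * z.2.1, z.2.1, X z.1 z.2.2 (z.1 + s * z.2.1))) := by
  have hI : ∀ z : ℝ × ℝ × E, z.1 ∈ I → z.1 + z.2.1 ∈ I → ∀ s ∈ Icc (0 : ℝ) 1,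
      z.1 + s * z.2.1 ∈ I := fun z h₁ h₂ s hs => by
    have := hIconn.convex.add_smul_mem h₁ h₂ hs
    rwa [smul_eq_mul] at this
  refine ⟨?_, ?_, ?_⟩
  · rintro ⟨τ, T, x⟩ ⟨hτ, -, hx⟩
    simp [hX₀ τ hτ x hx]
  · rintro z ⟨hτ, hT, hx⟩ s hs
    exact ⟨hI z hτ hT s hs, mem_univ _, hXM _ hτ _ hx _ (hI z hτ hT s hs)⟩
  · rintro z ⟨hτ, hT, hx⟩ s hs
    have hlin : HasDerivAt (fun s : ℝ => z.1 + s * z.2.1) z.2.1 s :=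
      (hasDerivAt_mul_const z.2.1).const_add z.1
    exact (hlin.prodMk ((hasDerivAt_const s z.2.1).prodMk
      ((hX _ hτ _ hx _ (hI z hτ hT s hs)).scomp s hlin))).hasDerivWithinAt

/-- The value at time `t` of the solution through `(τ, x)` is a `C^r` function of `(τ, t, x)`. -/
lemma contDiffOn_solution {E : Type} [NormedAddCommGroup E] [NormedSpace ℝ E] [CompleteSpace E]
    {I : Set ℝ} {M : Set E} {v : ℝ → E → E} {r : ℕ} (hr : 1 ≤ r) (hIopen : IsOpen I)
    (hIconn : I.OrdConnected) (hMopen : IsOpen M)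
    (hv : ContDiffOn ℝ r (fun p : ℝ × E => v p.1 p.2) (I ×ˢ M)) {X : ℝ → E → ℝ → E}
    (hX₀ : ∀ τ ∈ I, ∀ x ∈ M, X τ x τ = x) (hXM : ∀ τ ∈ I, ∀ x ∈ M, ∀ t ∈ I, X τ x t ∈ M)
    (hX : ∀ τ ∈ I, ∀ x ∈ M, ∀ t ∈ I, HasDerivAt (X τ x) (v t (X τ x t)) t) :
    ContDiffOn ℝ r (fun z : ℝ × ℝ × E => X z.1 z.2.2 z.2.1) (I ×ˢ I ×ˢ M) := by
  obtain ⟨r, rfl⟩ := Nat.exists_eq_add_of_le' hr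
  have hΩ : IsOpen {z : ℝ × ℝ × E | z.1 ∈ I ∧ z.1 + z.2.1 ∈ I ∧ z.2.2 ∈ M} :=
    (hIopen.preimage continuous_fst).inter ((hIopen.preimage (by fun_prop)).inter
      (hMopen.preimage (by fun_prop)))
  have hw : ContDiffOn ℝ (r + 1 : ℕ)
      (fun z : ℝ × ℝ × E => (z.2.1, (0 : ℝ), z.2.1 • v z.1 z.2.2)) (I ×ˢ univ ×ˢ M) := by
    have hd : ContDiffOn ℝ (r + 1 : ℕ) (fun z : ℝ × ℝ × E => z.2.1) (I ×ˢ univ ×ˢ M) := by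
      fun_prop
    exact hd.prodMk (contDiffOn_const.prodMk (hd.smul (hv.comp
      (contDiff_fst.prodMk (contDiff_snd.comp contDiff_snd)).contDiffOn
      fun z hz => ⟨hz.1, hz.2.2⟩)))
  have h := (isUnitTimeFlow_of_solution hIconn hX₀ hXM hX).contDiffOn r
    (hIopen.prod (isOpen_univ.prod hMopen)) hΩ hw 1 (by simp)
  have hshift : ContDiffOn ℝ (r + 1 : ℕ) (fun z : ℝ × ℝ × E => (z.1, z.2.1 - z.1, z.2.2))
      (I ×ˢ I ×ˢ M) := by fun_prop
  have hcomp := (contDiff_snd.comp contDiff_snd).comp_contDiffOn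
    (h.comp hshift fun z hz => ⟨hz.1, by simpa using hz.2.1, hz.2.2⟩)
  exact hcomp.congr fun z _ => by simp

end NonautonomousFlow

/-- The flow map `Φ(t, x₀) = (t, φ(t, x₀))` of the equation `ẋ = v(t,x)` is a
`C^r` diffeomorphism of `I × M` onto itself. -/
theorem flow_map_diffeomorphism {n : ℕ} (r : ℕ) (hr : 1 ≤ r)
    (I : Set ℝ) (hIopen : IsOpen I) (hIne : I.Nonempty) (hIconn : I.OrdConnected)
    (M : Set (EuclideanSpace ℝ (Fin n))) (hMopen : IsOpen M)
    (v : ℝ → EuclideanSpace ℝ (Fin n) → EuclideanSpace ℝ (Fin n))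
    (hv : ContDiffOn ℝ r (fun p : ℝ × EuclideanSpace ℝ (Fin n) => v p.1 p.2) (I ×ˢ M))
    (L : ℝ → ℝ) (hLcont : ContinuousOn L I) (hLnonneg : ∀ t ∈ I, 0 ≤ L t)
    (hLip : ∀ t ∈ I, ∀ x₁ ∈ M, ∀ x₂ ∈ M, ‖v t x₁ - v t x₂‖ ≤ L t * ‖x₁ - x₂‖)
    (hglobal : ∀ t₀ ∈ I, ∀ x₀ ∈ M, ∃ x : ℝ → EuclideanSpace ℝ (Fin n),
      x t₀ = x₀ ∧ (∀ t ∈ I, x t ∈ M) ∧ ∀ t ∈ I, HasDerivAt x (v t (x t)) t)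
    (t₀ : ℝ) (ht₀ : t₀ ∈ I)
    (φ : ℝ → EuclideanSpace ℝ (Fin n) → EuclideanSpace ℝ (Fin n))
    (hφ₀ : ∀ x₀ ∈ M, φ t₀ x₀ = x₀)
    (hφM : ∀ x₀ ∈ M, ∀ t ∈ I, φ t x₀ ∈ M)
    (hφ' : ∀ x₀ ∈ M, ∀ t ∈ I, HasDerivAt (fun s => φ s x₀) (v t (φ t x₀)) t) :
    ∃ Ψ : ℝ × EuclideanSpace ℝ (Fin n) → ℝ × EuclideanSpace ℝ (Fin n),
      Set.MapsTo (fun p : ℝ × EuclideanSpace ℝ (Fin n) => (p.1, φ p.1 p.2))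
        (I ×ˢ M) (I ×ˢ M) ∧
      Set.MapsTo Ψ (I ×ˢ M) (I ×ˢ M) ∧
      Set.InvOn Ψ (fun p : ℝ × EuclideanSpace ℝ (Fin n) => (p.1, φ p.1 p.2))
        (I ×ˢ M) (I ×ˢ M) ∧
      ContDiffOn ℝ r (fun p : ℝ × EuclideanSpace ℝ (Fin n) => (p.1, φ p.1 p.2)) (I ×ˢ M) ∧
      ContDiffOn ℝ r Ψ (I ×ˢ M) := by
  choose! X hX₀ hXM hX using hglobal
  have hsmooth := contDiffOn_solution hr hIopen hIconn hMopen hv hX₀ hXM hX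
  have hunique : ∀ {x y : ℝ → EuclideanSpace ℝ (Fin n)}, (∀ t ∈ I, x t ∈ M) →
      (∀ t ∈ I, HasDerivAt x (v t (x t)) t) → (∀ t ∈ I, y t ∈ M) →
      (∀ t ∈ I, HasDerivAt y (v t (y t)) t) → ∀ t₁ ∈ I, x t₁ = y t₁ → EqOn x y I :=
    fun hxM hx hyM hy t₁ ht₁ =>
      solution_unique_of_continuousOn_lipschitz hIopen hIconn hLcont hLip hxM hx hyM hy ht₁
  have hφX : ∀ x ∈ M, ∀ t ∈ I, φ t x = X t₀ x t := fun x hx t ht =>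
    hunique (hφM x hx) (hφ' x hx) (hXM t₀ ht₀ x hx) (hX t₀ ht₀ x hx) t₀ ht₀
      ((hφ₀ x hx).trans (hX₀ t₀ ht₀ x hx).symm) ht
  refine ⟨fun p => (p.1, X p.1 p.2 t₀), fun p hp => ⟨hp.1, hφM p.2 hp.2 p.1 hp.1⟩,
    fun p hp => ⟨hp.1, hXM p.1 hp.1 p.2 hp.2 t₀ ht₀⟩, ⟨?_, ?_⟩, ?_, ?_⟩
  · rintro ⟨t, x⟩ ⟨ht, hx⟩
    have hy := hφM x hx t ht
    have h := hunique (hXM t ht _ hy) (hX t ht _ hy) (hφM x hx) (hφ' x hx) t ht (hX₀ t ht _ hy) ht₀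
    exact Prod.ext rfl (h.trans (hφ₀ x hx))
  · rintro ⟨t, x⟩ ⟨ht, hx⟩
    have hy := hXM t ht x hx t₀ ht₀
    have h := hunique (hφM _ hy) (hφ' _ hy) (hXM t ht x hx) (hX t ht x hx) t₀ ht₀ (hφ₀ _ hy) ht
    exact Prod.ext rfl (h.trans (hX₀ t ht x hx))
  · have hm : ContDiffOn ℝ r (fun p : ℝ × EuclideanSpace ℝ (Fin n) => (t₀, p.1, p.2))
        (I ×ˢ M) := by fun_prop
    exact contDiffOn_fst.prodMk ((hsmooth.comp hm fun p hp => ⟨ht₀, hp.1, hp.2⟩).congr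
      fun p hp => hφX p.2 hp.2 p.1 hp.1)
  · have hm : ContDiffOn ℝ r (fun p : ℝ × EuclideanSpace ℝ (Fin n) => (p.1, t₀, p.2))
        (I ×ˢ M) := by fun_prop
    exact contDiffOn_fst.prodMk (hsmooth.comp hm fun p hp => ⟨hp.1, ht₀, hp.2⟩)
end

section
/- Let I ⊆ ℝ be a nonempty open interval, M ⊆ ℝⁿ an open set, r ≥ 1, and v : I × M → ℝⁿ an r times continuously differentiable function. Then the direction field of the equation ẋ = v(t,x) is locally rectifiable: every point (t₀, x₀) ∈ I × M admits an open neighbourhood U ⊆ I × M and a C^r diffeomorphism Ψ of U onto an open subset of ℝ × ℝⁿ such that the pushforward under Ψ of the vector field (t,x) ↦ (1, v(t,x)) restricted to U is the constant vector field with value (1, 0). -/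
open Set Filter Topology

universe u

section Composition

variable {K : Type*} [TopologicalSpace K] [CompactSpace K]
  {E F : Type u} [NormedAddCommGroup E] [NormedSpace ℝ E]
  [NormedAddCommGroup F] [NormedSpace ℝ F]

/-- Pointwise application of a continuous family of continuous linear maps to a continuous map,
as a continuous bilinear map. -/
noncomputable def ContinuousMap.pointwiseApply :
    C(K, E →L[ℝ] F) →L[ℝ] C(K, E) →L[ℝ] C(K, F) :=
  LinearMap.mkContinuous₂
    (LinearMap.mk₂ ℝ (fun (A : C(K, E →L[ℝ] F)) (γ : C(K, E)) ↦
      (⟨fun s ↦ A s (γ s), by fun_prop⟩ : C(K, F)))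
      (fun _ _ _ ↦ by ext; simp) (fun _ _ _ ↦ by ext; simp)
      (fun _ _ _ ↦ by ext; simp) (fun _ _ _ ↦ by ext; simp)) 1 (by
      intro A γ
      rw [ContinuousMap.norm_le _ (by positivity)]
      intro s
      rw [one_mul]
      exact (A s).le_of_opNorm_le_of_le (A.norm_coe_le_norm s) (γ.norm_coe_le_norm s))

/-- The composition operator `γ ↦ f ∘ γ` of a `C¹` map `f` is differentiable. -/
theorem ContinuousMap.hasFDerivAt_comp_left {f : C(E, F)} {f' : C(E, E →L[ℝ] F)}
    (hf : ∀ x, HasFDerivAt f (f' x) x) (γ : C(K, E)) :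
    HasFDerivAt (fun γ : C(K, E) ↦ f.comp γ) (pointwiseApply (f'.comp γ)) γ := by
  rw [hasFDerivAt_iff_isLittleO, Asymptotics.isLittleO_iff]
  intro c hc
  have hcont : ContinuousAt (fun γ : C(K, E) ↦ f'.comp γ) γ :=
    (ContinuousMap.continuous_postcomp f').continuousAt
  obtain ⟨δ, hδ, hball⟩ :=
    (Metric.continuousAt_iff (α := C(K, E)) (β := C(K, E →L[ℝ] F))).1 hcont c hc
  filter_upwards [Metric.ball_mem_nhds γ hδ] with η hη
  rw [ContinuousMap.norm_le _ (by positivity)]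
  intro s
  have hbound : ∀ z ∈ Metric.ball (γ s) δ, ‖f' z - f' (γ s)‖ ≤ c := by
    intro z hz
    have hconst : dist (γ + ContinuousMap.const K (z - γ s)) γ < δ := by
      rw [dist_self_add_left]
      refine lt_of_le_of_lt ((ContinuousMap.norm_le _ (norm_nonneg (z - γ s))).2 fun _ ↦ le_rfl) ?_
      rwa [← dist_eq_norm]
    have := (ContinuousMap.dist_apply_le_dist s).trans (hball hconst).le
    simpa [dist_eq_norm] using this
  have hηs : η s ∈ Metric.ball (γ s) δ :=
    (ContinuousMap.dist_apply_le_dist s).trans_lt hη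
  have := (convex_ball (γ s) δ).norm_image_sub_le_of_norm_hasFDerivWithin_le'
    (fun z _ ↦ (hf z).hasFDerivWithinAt) hbound (Metric.mem_ball_self hδ) hηs
  refine this.trans ?_
  gcongr
  exact (η - γ).norm_coe_le_norm s

/-- The composition operator `γ ↦ f ∘ γ` of a `Cʳ` map `f` is `Cʳ`. -/
theorem ContinuousMap.contDiff_comp_left (r : ℕ) :
    ∀ {F : Type u} [NormedAddCommGroup F] [NormedSpace ℝ F] (f : C(E, F)),
      ContDiff ℝ r f → ContDiff ℝ r (fun γ : C(K, E) ↦ f.comp γ) := by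
  induction r with
  | zero =>
    intro F _ _ f _
    exact contDiff_zero.2 (ContinuousMap.continuous_postcomp f)
  | succ r ih =>
    intro F _ _ f hf
    rw [Nat.cast_succ, contDiff_succ_iff_hasFDerivAt] at hf
    obtain ⟨f', hf', hderiv⟩ := hf
    rw [Nat.cast_succ, contDiff_succ_iff_hasFDerivAt]
    let g : C(E, E →L[ℝ] F) := ⟨f', hf'.continuous⟩
    have happly : ContDiff ℝ r (pointwiseApply (K := K) (E := E) (F := F)) :=
      ContinuousLinearMap.contDiff _
    exact ⟨fun γ ↦ pointwiseApply (g.comp γ), happly.comp (ih g hf'),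
      fun γ ↦ ContinuousMap.hasFDerivAt_comp_left hderiv γ⟩

end Composition

section Flow

variable {E : Type u} [NormedAddCommGroup E]

/-- The continuous extension to `ℝ` of a curve defined on `[-1, 1]`. -/
noncomputable def curveExtend (γ : C(Icc (-1 : ℝ) 1, E)) (t : ℝ) : E :=
  γ (projIcc (-1) 1 (by norm_num) t)

theorem continuous_curveExtend (γ : C(Icc (-1 : ℝ) 1, E)) : Continuous (curveExtend γ) :=
  γ.continuous.comp continuous_projIcc

theorem curveExtend_coe (γ : C(Icc (-1 : ℝ) 1, E)) (s : Icc (-1 : ℝ) 1) :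
    curveExtend γ s = γ s := by
  simp [curveExtend]

theorem abs_coe_le_one (s : Icc (-1 : ℝ) 1) : |(s : ℝ)| ≤ 1 :=
  abs_le.2 s.2

/-- The reparametrization `τ ↦ γ (s τ)` of a curve, for `s ∈ [-1, 1]`. -/
def rescaleCurve (s : Icc (-1 : ℝ) 1) (γ : C(Icc (-1 : ℝ) 1, E)) : C(Icc (-1 : ℝ) 1, E) :=
  γ.comp ⟨fun τ ↦ ⟨s * τ, abs_le.1 (by
    rw [abs_mul]
    exact mul_le_one₀ (abs_coe_le_one s) (abs_nonneg _) (abs_coe_le_one τ))⟩, by fun_prop⟩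

theorem curveExtend_rescaleCurve (s : Icc (-1 : ℝ) 1) (γ : C(Icc (-1 : ℝ) 1, E)) {τ : ℝ}
    (hτ : τ ∈ Icc (-1 : ℝ) 1) : curveExtend (rescaleCurve s γ) τ = curveExtend γ (s * τ) := by
  lift τ to Icc (-1 : ℝ) 1 using hτ
  rw [curveExtend_coe]
  exact (curveExtend_coe γ _).symm

variable [NormedSpace ℝ E]

/-- The continuous linear operator taking a curve on `[-1, 1]` to its primitive vanishing
at `0`. -/
noncomputable def curvePrimitive : C(Icc (-1 : ℝ) 1, E) →L[ℝ] C(Icc (-1 : ℝ) 1, E) :=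
  LinearMap.mkContinuous
    { toFun := fun γ ↦ ⟨fun s ↦ ∫ τ in (0 : ℝ)..s, curveExtend γ τ,
        (intervalIntegral.continuous_primitive
          (fun _ _ ↦ (continuous_curveExtend γ).intervalIntegrable _ _) 0).comp
          continuous_subtype_val⟩
      map_add' := fun γ η ↦ by
        ext s
        exact intervalIntegral.integral_add
          ((continuous_curveExtend γ).intervalIntegrable _ _)
          ((continuous_curveExtend η).intervalIntegrable _ _)
      map_smul' := fun c γ ↦ by
        ext s
        exact intervalIntegral.integral_smul c _ }
    1 (by
      intro γ
      rw [one_mul, ContinuousMap.norm_le _ (norm_nonneg γ)]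
      intro s
      refine (intervalIntegral.norm_integral_le_of_norm_le_const
        (fun τ _ ↦ γ.norm_coe_le_norm _)).trans ?_
      rw [sub_zero]
      exact mul_le_of_le_one_right (norm_nonneg γ) (abs_coe_le_one s))

theorem curvePrimitive_apply (γ : C(Icc (-1 : ℝ) 1, E)) (s : Icc (-1 : ℝ) 1) :
    curvePrimitive γ s = ∫ τ in (0 : ℝ)..s, curveExtend γ τ :=
  rfl

/-- Constant curves on `[-1, 1]`, as a continuous linear map. -/
noncomputable def constCurve : E →L[ℝ] C(Icc (-1 : ℝ) 1, E) :=
  LinearMap.mkContinuous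
    { toFun := fun x ↦ ContinuousMap.const _ x
      map_add' := fun _ _ ↦ rfl
      map_smul' := fun _ _ ↦ rfl } 1 (by
      intro x
      rw [one_mul, ContinuousMap.norm_le _ (norm_nonneg x)]
      exact fun _ ↦ le_rfl)

@[simp]
theorem constCurve_apply (x : E) (s : Icc (-1 : ℝ) 1) : constCurve x s = x :=
  rfl

/-- The defect of `γ` as a solution of the integral equation
`γ s = x + ε ∫₀ˢ w (γ τ) dτ`. -/
noncomputable def flowDefect (w : C(E, E)) (p : (ℝ × E) × C(Icc (-1 : ℝ) 1, E)) :
    C(Icc (-1 : ℝ) 1, E) :=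
  p.2 - constCurve p.1.2 - p.1.1 • curvePrimitive (w.comp p.2)

theorem contDiff_flowDefect {w : C(E, E)} {r : ℕ} (hw : ContDiff ℝ r w) :
    ContDiff ℝ r (flowDefect w) := by
  have hcomp : ContDiff ℝ r (fun p : (ℝ × E) × C(Icc (-1 : ℝ) 1, E) ↦ w.comp p.2) :=
    (ContinuousMap.contDiff_comp_left r w hw).comp contDiff_snd
  exact (contDiff_snd.sub (constCurve.contDiff.comp contDiff_fst.snd)).sub
    (contDiff_fst.fst.smul (curvePrimitive.contDiff.comp hcomp))

theorem fderiv_flowDefect_comp_inr {w : C(E, E)} {r : ℕ} (hr : r ≠ 0) (hw : ContDiff ℝ r w)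
    (x : E) (γ : C(Icc (-1 : ℝ) 1, E)) :
    fderiv ℝ (flowDefect w) ((0, x), γ) ∘L .inr ℝ (ℝ × E) C(Icc (-1 : ℝ) 1, E) =
      ContinuousLinearMap.id ℝ _ := by
  have hd : HasFDerivAt (flowDefect w) (fderiv ℝ (flowDefect w) ((0, x), γ)) ((0, x), γ) :=
    ((contDiff_flowDefect hw).differentiable (by exact_mod_cast hr) _).hasFDerivAt
  have hcomp := hd.comp γ (hasFDerivAt_prodMk_right (𝕜 := ℝ) (0, x) γ)
  refine hcomp.unique ?_
  have : (flowDefect w ∘ fun η ↦ ((0, x), η)) = fun η ↦ η - constCurve x := by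
    ext η s
    simp [flowDefect]
  rw [this]
  exact (hasFDerivAt_id γ).sub_const _

theorem dist_rescaleCurve_constCurve_le (s : Icc (-1 : ℝ) 1) (γ : C(Icc (-1 : ℝ) 1, E)) (x : E) :
    dist (rescaleCurve s γ) (constCurve x) ≤ dist γ (constCurve x) :=
  (ContinuousMap.dist_le dist_nonneg).2 fun _ ↦
    ContinuousMap.dist_apply_le_dist (f := γ) (g := constCurve x) _

theorem curvePrimitive_rescaleCurve (s σ : Icc (-1 : ℝ) 1) (γ : C(Icc (-1 : ℝ) 1, E)) :
    (s : ℝ) • curvePrimitive (rescaleCurve s γ) σ = rescaleCurve s (curvePrimitive γ) σ := by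
  have hint : ∫ τ in (0 : ℝ)..σ, curveExtend (rescaleCurve s γ) τ =
      ∫ τ in (0 : ℝ)..σ, curveExtend γ (s * τ) := by
    refine intervalIntegral.integral_congr fun τ hτ ↦ curveExtend_rescaleCurve s γ ?_
    exact uIcc_subset_Icc (by norm_num) σ.2 hτ
  rw [curvePrimitive_apply, hint, intervalIntegral.smul_integral_comp_mul_left, mul_zero]
  rfl

theorem flowDefect_rescaleCurve (w : C(E, E)) (s : Icc (-1 : ℝ) 1) (ε : ℝ) (x : E)
    (γ : C(Icc (-1 : ℝ) 1, E)) :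
    flowDefect w ((s * ε, x), rescaleCurve s γ) = rescaleCurve s (flowDefect w ((ε, x), γ)) := by
  ext σ
  have := curvePrimitive_rescaleCurve s σ (w.comp γ)
  change rescaleCurve s γ σ - x - (s * ε) • curvePrimitive (rescaleCurve s (w.comp γ)) σ =
    rescaleCurve s γ σ - x - ε • rescaleCurve s (curvePrimitive (w.comp γ)) σ
  rw [← this, smul_smul, mul_comm]

theorem hasDerivAt_curvePrimitive [CompleteSpace E] (γ : C(Icc (-1 : ℝ) 1, E)) (t : ℝ) :
    HasDerivAt (fun t ↦ ∫ τ in (0 : ℝ)..t, curveExtend γ τ) (curveExtend γ t) t :=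
  intervalIntegral.integral_hasDerivAt_right
    ((continuous_curveExtend γ).intervalIntegrable _ _)
    ((continuous_curveExtend γ).stronglyMeasurableAtFilter _ _)
    (continuous_curveExtend γ).continuousAt

/-- A curve solving the rescaled integral equation, run at its original speed, is an integral
curve. -/
theorem hasDerivAt_curveExtend_of_flowDefect_eq_zero [CompleteSpace E] {w : C(E, E)} {ε : ℝ}
    (hε : 0 < ε) {x : E} {γ : C(Icc (-1 : ℝ) 1, E)} (h : flowDefect w ((ε, x), γ) = 0) {t : ℝ}
    (ht : |t| < ε) :
    HasDerivAt (fun t ↦ curveExtend γ (t / ε)) (w (curveExtend γ (t / ε))) t := by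
  have heq : ∀ t, |t| < ε →
      curveExtend γ (t / ε) = x + ε • ∫ τ in (0 : ℝ)..t / ε, curveExtend (w.comp γ) τ := by
    intro t ht
    have hmem : t / ε ∈ Icc (-1 : ℝ) 1 :=
      abs_le.1 (by rw [abs_div, abs_of_pos hε]; exact ((div_lt_one hε).2 ht).le)
    have hs := DFunLike.congr_fun h ⟨t / ε, hmem⟩
    change γ ⟨t / ε, hmem⟩ - x - ε • curvePrimitive (w.comp γ) ⟨t / ε, hmem⟩ = 0 at hs
    rw [sub_sub, sub_eq_zero, curvePrimitive_apply] at hs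
    rw [← hs]
    exact curveExtend_coe γ ⟨t / ε, hmem⟩
  have hd : HasDerivAt (fun t ↦ x + ε • ∫ τ in (0 : ℝ)..t / ε, curveExtend (w.comp γ) τ)
      (w (curveExtend γ (t / ε))) t := by
    have := (((hasDerivAt_curvePrimitive (w.comp γ) (t / ε)).scomp t
      ((hasDerivAt_id t).div_const ε)).const_smul ε).const_add x
    convert! this using 1
    rw [smul_smul, mul_one_div_cancel hε.ne', one_smul]
    rfl
  refine hd.congr_of_eventuallyEq ?_
  filter_upwards [(continuous_abs.isOpen_preimage _ isOpen_Iio).mem_nhds ht] with t ht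
  exact heq t ht

/-- The local flow of a `Cʳ` vector field is jointly `Cʳ` in time and initial condition. -/
theorem exists_contDiffAt_flow [CompleteSpace E] {w : C(E, E)} {r : ℕ} (hr : r ≠ 0)
    (hw : ContDiff ℝ r w) (x₀ : E) :
    ∃ Φ : ℝ × E → E, ContDiffAt ℝ r Φ (0, x₀) ∧ (∀ᶠ x in 𝓝 x₀, Φ (0, x) = x) ∧
      ∀ᶠ p in 𝓝 ((0 : ℝ), x₀), HasDerivAt (fun t ↦ Φ (t, p.2)) (w (Φ p)) p.1 := by
  have hr' : (r : WithTop ℕ∞) ≠ 0 := by exact_mod_cast hr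
  have hcd : ContDiffAt ℝ r (flowDefect w) ((0, x₀), constCurve x₀) :=
    (contDiff_flowDefect hw).contDiffAt
  have hinv : (fderiv ℝ (flowDefect w) ((0, x₀), constCurve x₀) ∘L
      .inr ℝ (ℝ × E) C(Icc (-1 : ℝ) 1, E)).IsInvertible := by
    rw [fderiv_flowDefect_comp_inr hr hw]
    exact ⟨ContinuousLinearEquiv.refl ℝ _, rfl⟩
  have hbase : flowDefect w ((0, x₀), constCurve x₀) = 0 := by simp [flowDefect]
  have hψ₀ := hcd.implicitFunction_apply_self hr' hinv
  have hψ := hcd.contDiffAt_implicitFunction hr' hinv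
  have hsol := hcd.eventually_apply_implicitFunction hr' hinv
  have huniq := hcd.eventually_apply_eq_iff_implicitFunction hr' hinv
  set ψ := hcd.implicitFunction hr' hinv
  simp only [hbase] at hψ₀ hψ hsol huniq
  let one : Icc (-1 : ℝ) 1 := ⟨1, by norm_num⟩
  obtain ⟨δ, hδ, hball⟩ := Metric.eventually_nhds_iff.1 huniq
  have hnear : ∀ᶠ p in 𝓝 ((0 : ℝ), x₀), dist (ψ p) (constCurve x₀) < δ := by
    have := hψ.continuousAt.eventually (Metric.ball_mem_nhds _ hδ)
    rwa [hψ₀] at this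
  obtain ⟨ρ, hρ, hgood⟩ := Metric.eventually_nhds_iff.1 (hsol.and hnear)
  -- rescaling identifies the curve at parameter `s * ε` with a reparametrized one
  have hscale : ∀ (s : Icc (-1 : ℝ) 1) (ε : ℝ) (x : E), |ε| < ρ → |ε| < δ → dist x x₀ < ρ →
      dist x x₀ < δ → ψ (s * ε, x) = rescaleCurve s (ψ (ε, x)) := by
    intro s ε x hερ hεδ hxρ hxδ
    obtain ⟨hs, hn⟩ := hgood (y := (ε, x)) (by simp [Prod.dist_eq, hερ, hxρ])
    refine (hball (y := ((s * ε, x), rescaleCurve s (ψ (ε, x)))) ?_).1 ?_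
    · have : |(s : ℝ) * ε| ≤ |ε| := by
        rw [abs_mul]
        exact mul_le_of_le_one_left (abs_nonneg _) (abs_coe_le_one s)
      have h1 := this.trans_lt hεδ
      have h2 := (dist_rescaleCurve_constCurve_le s (ψ (ε, x)) x₀).trans_lt hn
      simp only [Prod.dist_eq, max_lt_iff, Real.dist_eq, sub_zero]
      exact ⟨⟨h1, hxδ⟩, h2⟩
    · rw [flowDefect_rescaleCurve, hs]
      rfl
  have hflow : ∀ (s : Icc (-1 : ℝ) 1) (ε : ℝ) (x : E), |ε| < ρ → |ε| < δ → dist x x₀ < ρ →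
      dist x x₀ < δ → ψ (s * ε, x) one = ψ (ε, x) s := by
    intro s ε x h1 h2 h3 h4
    rw [hscale s ε x h1 h2 h3 h4]
    change ψ (ε, x) ⟨s * 1, _⟩ = _
    congr 1
    exact Subtype.ext (mul_one _)
  have heval : ContDiff ℝ r (ContinuousMap.evalCLM ℝ one : C(Icc (-1 : ℝ) 1, E) →L[ℝ] E) :=
    ContinuousLinearMap.contDiff _
  refine ⟨fun p ↦ ψ p one, heval.contDiffAt.comp _ hψ, ?_, ?_⟩
  · have : ContinuousAt (fun x : E ↦ ((0 : ℝ), x)) x₀ := by fun_prop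
    filter_upwards [this.eventually hsol] with x hx
    have := DFunLike.congr_fun hx one
    simpa [flowDefect, sub_eq_zero] using this
  · obtain ⟨ε, hε, hεlt⟩ := exists_between (lt_min hρ hδ)
    obtain ⟨hερ, hεδ⟩ := lt_min_iff.1 hεlt
    have hε' : |ε| = ε := abs_of_pos hε
    filter_upwards [Metric.ball_mem_nhds ((0 : ℝ), x₀) hε] with p hp
    obtain ⟨t, x⟩ := p
    simp only [Metric.mem_ball, Prod.dist_eq, max_lt_iff, Real.dist_eq, sub_zero] at hp
    obtain ⟨ht, hx⟩ := hp
    have hzero := (hgood (y := (ε, x)) (by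
      simp [Prod.dist_eq, hε', hερ, hx.trans hερ])).1
    have heq : ∀ t, |t| < ε → ψ (t, x) one = curveExtend (ψ (ε, x)) (t / ε) := by
      intro t ht
      have hmem : t / ε ∈ Icc (-1 : ℝ) 1 :=
        abs_le.1 (by rw [abs_div, hε']; exact ((div_lt_one hε).2 ht).le)
      have := hflow ⟨t / ε, hmem⟩ ε x (hε'.trans_lt hερ) (hε'.trans_lt hεδ)
        (hx.trans hερ) (hx.trans hεδ)
      rw [← curveExtend_coe (ψ (ε, x))] at this
      simpa [div_mul_cancel₀ t hε.ne'] using this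
    have hd := hasDerivAt_curveExtend_of_flowDefect_eq_zero hε hzero ht
    rw [← heq t ht] at hd
    refine hd.congr_of_eventuallyEq ?_
    filter_upwards [(continuous_abs.isOpen_preimage _ isOpen_Iio).mem_nhds ht] with t ht
    exact heq t ht

/-- A `Cʳ` map near a point agrees near this point with a globally defined `Cʳ` map. -/
theorem exists_contDiff_eventuallyEq_of_contDiffAt [FiniteDimensional ℝ E] {f : E → E} {x₀ : E}
    {r : ℕ} (hf : ContDiffAt ℝ r f x₀) : ∃ g : E → E, ContDiff ℝ r g ∧ g =ᶠ[𝓝 x₀] f := by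
  have hev := hf.eventually (by simp)
  obtain ⟨ρ, hρ, hball⟩ := Metric.eventually_nhds_iff.1 hev
  let φ : ContDiffBump x₀ := ⟨ρ / 4, ρ / 2, by positivity, by linarith⟩
  refine ⟨fun x ↦ φ x • f x, contDiff_iff_contDiffAt.2 fun x ↦ ?_, ?_⟩
  · by_cases hx : dist x x₀ < ρ
    · exact φ.contDiffAt.smul (hball hx)
    · refine contDiffAt_const (c := (0 : E)) |>.congr_of_eventuallyEq ?_
      have : x ∉ tsupport φ := by
        rw [φ.tsupport_eq, Metric.mem_closedBall]
        change ¬ dist x x₀ ≤ ρ / 2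
        linarith
      filter_upwards [notMem_tsupport_iff_eventuallyEq.1 this] with y hy
      simp [hy]
  · filter_upwards [φ.eventuallyEq_one] with x hx
    simp [hx]

end Flow

section Rectification

variable {E : Type u} [NormedAddCommGroup E] [NormedSpace ℝ E]

/-- The linear automorphism `(a, y) ↦ (a, a • v + y)` of `ℝ × E`. -/
noncomputable def shearEquiv (v : E) : (ℝ × E) ≃L[ℝ] (ℝ × E) :=
  ContinuousLinearEquiv.equivOfInverse
    ((ContinuousLinearMap.fst ℝ ℝ E).prod
      ((ContinuousLinearMap.fst ℝ ℝ E).smulRight v + ContinuousLinearMap.snd ℝ ℝ E))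
    ((ContinuousLinearMap.fst ℝ ℝ E).prod
      (ContinuousLinearMap.snd ℝ ℝ E - (ContinuousLinearMap.fst ℝ ℝ E).smulRight v))
    (fun p ↦ by ext <;> simp) (fun p ↦ by ext <;> simp)

theorem shearEquiv_apply (v : E) (p : ℝ × E) : shearEquiv v p = (p.1, p.1 • v + p.2) :=
  rfl

/-- A local `Cʳ` parametrization of `ℝ × E` whose coordinate lines `y = const` are integral curves
of the vector field `w`, when `w` is transverse to the hyperplane `{t₀} × E`. -/
theorem exists_contDiffAt_flowBox [FiniteDimensional ℝ E] {w : ℝ × E → ℝ × E} {r : ℕ}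
    (hr : r ≠ 0) {t₀ : ℝ} {x₀ v₀ : E} (hw : ContDiffAt ℝ r w (t₀, x₀))
    (hw₀ : w (t₀, x₀) = (1, v₀)) :
    ∃ Θ : ℝ × E → ℝ × E, ContDiffAt ℝ r Θ (t₀, x₀) ∧ Θ (t₀, x₀) = (t₀, x₀) ∧
      HasFDerivAt Θ (shearEquiv v₀ : ℝ × E →L[ℝ] ℝ × E) (t₀, x₀) ∧
      ∀ᶠ q in 𝓝 (t₀, x₀), fderiv ℝ Θ q (1, 0) = w (Θ q) := by
  have : CompleteSpace E := FiniteDimensional.complete ℝ E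
  have hr' : (r : WithTop ℕ∞) ≠ 0 := by exact_mod_cast hr
  obtain ⟨g, hg, hgw⟩ := exists_contDiff_eventuallyEq_of_contDiffAt hw
  obtain ⟨Φ, hΦ, hΦ₀, hΦd⟩ :=
    exists_contDiffAt_flow (w := ⟨g, hg.continuous⟩) hr hg (t₀, x₀)
  let κ : ℝ × E → ℝ × (ℝ × E) := fun q ↦ (q.1 - t₀, (t₀, q.2))
  have hκ : ContDiff ℝ r κ := by fun_prop
  have hκ₀ : κ (t₀, x₀) = (0, (t₀, x₀)) := by simp [κ]
  have hΘ : ContDiffAt ℝ r (Φ ∘ κ) (t₀, x₀) :=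
    ContDiffAt.comp _ (by rwa [hκ₀]) hκ.contDiffAt
  have hκt : Tendsto κ (𝓝 (t₀, x₀)) (𝓝 (0, (t₀, x₀))) := by
    simpa [hκ₀] using hκ.continuous.tendsto (t₀, x₀)
  have hΘ₀ : (Φ ∘ κ) (t₀, x₀) = (t₀, x₀) := by
    rw [Function.comp_apply, hκ₀]
    exact hΦ₀.self_of_nhds
  have hΘw : ∀ᶠ q in 𝓝 (t₀, x₀), fderiv ℝ (Φ ∘ κ) q (1, 0) = w ((Φ ∘ κ) q) := by
    have hgw' : ∀ᶠ q in 𝓝 (t₀, x₀), g ((Φ ∘ κ) q) = w ((Φ ∘ κ) q) := by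
      have := hΘ.continuousAt.tendsto
      rw [hΘ₀] at this
      exact this.eventually hgw
    filter_upwards [hκt.eventually hΦd, hgw', hΘ.eventually (by simp)] with q hq hgq hcq
    rw [← hgq]
    have hline : HasDerivAt (fun t : ℝ ↦ (t, q.2)) ((1 : ℝ), (0 : E)) q.1 :=
      (hasDerivAt_id q.1).prodMk (hasDerivAt_const _ _)
    have h₁ : HasDerivAt (fun t ↦ (Φ ∘ κ) (t, q.2)) (fderiv ℝ (Φ ∘ κ) q (1, 0)) q.1 :=
      (hcq.differentiableAt hr').hasFDerivAt.comp_hasDerivAt q.1 hline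
    exact h₁.unique (HasDerivAt.comp_sub_const q.1 t₀ hq)
  refine ⟨Φ ∘ κ, hΘ, hΘ₀, ?_, hΘw⟩
  have hd := (hΘ.differentiableAt hr').hasFDerivAt
  have hinl : fderiv ℝ (Φ ∘ κ) (t₀, x₀) (1, 0) = (1, v₀) := by
    rw [hΘw.self_of_nhds, hΘ₀, hw₀]
  have hinr : ∀ y, fderiv ℝ (Φ ∘ κ) (t₀, x₀) (0, y) = (0, y) := by
    have hι := hasFDerivAt_prodMk_right (𝕜 := ℝ) t₀ x₀
    have heq : ((Φ ∘ κ) ∘ fun y ↦ (t₀, y)) =ᶠ[𝓝 x₀] fun y ↦ (t₀, y) := by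
      have : ContinuousAt (fun y : E ↦ (t₀, y)) x₀ := by fun_prop
      filter_upwards [this.eventually hΦ₀] with y hy
      simpa [κ] using hy
    have := (hd.comp x₀ hι).unique (hι.congr_of_eventuallyEq heq)
    exact fun y ↦ by simpa using DFunLike.congr_fun this y
  have heq : fderiv ℝ (Φ ∘ κ) (t₀, x₀) = (shearEquiv v₀ : ℝ × E →L[ℝ] ℝ × E) := by
    refine ContinuousLinearMap.ext fun p ↦ ?_
    have hp : p = p.1 • ((1 : ℝ), (0 : E)) + (0, p.2) := by ext <;> simp
    rw [ContinuousLinearEquiv.coe_coe, shearEquiv_apply]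
    conv_lhs => rw [hp, map_add, map_smul, hinl, hinr]
    ext <;> simp
  rwa [heq] at hd

end Rectification

/-- **Local rectification theorem.** Every point `(t₀, x₀) ∈ I × M` has an open
neighbourhood `U ⊆ I × M` on which the direction field of `ẋ = v(t,x)` can be
rectified by a `C^r` diffeomorphism `Ψ : U → V` onto an open set `V ⊆ ℝ × ℝⁿ`:
the pushforward under `Ψ` of the vector field `(t,x) ↦ (1, v(t,x))` restricted
to `U` is the constant vector field `(1, 0)`. -/
theorem local_rectification {n : ℕ} (r : ℕ) (hr : 1 ≤ r)
    (I : Set ℝ) (hIopen : IsOpen I) (hIne : I.Nonempty) (hIconn : I.OrdConnected)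
    (M : Set (EuclideanSpace ℝ (Fin n))) (hMopen : IsOpen M)
    (v : ℝ → EuclideanSpace ℝ (Fin n) → EuclideanSpace ℝ (Fin n))
    (hv : ContDiffOn ℝ r (fun p : ℝ × EuclideanSpace ℝ (Fin n) => v p.1 p.2) (I ×ˢ M)) :
    ∀ t₀ ∈ I, ∀ x₀ ∈ M,
      ∃ U : Set (ℝ × EuclideanSpace ℝ (Fin n)), IsOpen U ∧ (t₀, x₀) ∈ U ∧ U ⊆ I ×ˢ M ∧
      ∃ V : Set (ℝ × EuclideanSpace ℝ (Fin n)), IsOpen V ∧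
      ∃ Ψ Θ : ℝ × EuclideanSpace ℝ (Fin n) → ℝ × EuclideanSpace ℝ (Fin n),
        Set.MapsTo Ψ U V ∧ Set.MapsTo Θ V U ∧ Set.InvOn Θ Ψ U V ∧
        Set.SurjOn Ψ U V ∧
        ContDiffOn ℝ r Ψ U ∧ ContDiffOn ℝ r Θ V ∧
        ∀ p ∈ U, fderiv ℝ Ψ p ((1 : ℝ), v p.1 p.2)
          = ((1 : ℝ), (0 : EuclideanSpace ℝ (Fin n))) := by
  intro t₀ ht₀ x₀ hx₀
  have hr₀ : r ≠ 0 := by omega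
  have hr' : (r : WithTop ℕ∞) ≠ 0 := by exact_mod_cast hr₀
  have hIM : IsOpen (I ×ˢ M) := hIopen.prod hMopen
  have hw : ContDiffAt ℝ r
      (fun p : ℝ × EuclideanSpace ℝ (Fin n) ↦ ((1 : ℝ), v p.1 p.2)) (t₀, x₀) :=
    contDiffAt_const.prodMk (hv.contDiffAt (hIM.mem_nhds ⟨ht₀, hx₀⟩))
  obtain ⟨Θ, hΘ, hΘ₀, hΘd, hΘw⟩ := exists_contDiffAt_flowBox hr₀ hw rfl
  let e := hΘ.toOpenPartialHomeomorph Θ hΘd hr'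
  have hmem : (t₀, x₀) ∈ e.source := hΘ.mem_toOpenPartialHomeomorph_source hΘd hr'
  have hsymm : ContDiffAt ℝ r e.symm (Θ (t₀, x₀)) := hΘ.to_localInverse hΘd hr'
  have hgood : ∀ᶠ q in 𝓝 (t₀, x₀), q ∈ e.source ∧ Θ q ∈ I ×ˢ M ∧ ContDiffAt ℝ r Θ q ∧
      ContDiffAt ℝ r e.symm (Θ q) ∧ fderiv ℝ Θ q (1, 0) = (1, v (Θ q).1 (Θ q).2) := by
    have hIM' : I ×ˢ M ∈ 𝓝 (Θ (t₀, x₀)) := hΘ₀.symm ▸ hIM.mem_nhds (mk_mem_prod ht₀ hx₀)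
    filter_upwards [e.open_source.mem_nhds hmem, hΘ.continuousAt hIM', hΘ.eventually (by simp),
      hΘ.continuousAt.eventually (hsymm.eventually (by simp)), hΘw] with q h₁ h₂ h₃ h₄ h₅
    exact ⟨h₁, h₂, h₃, h₄, h₅⟩
  obtain ⟨V, hV, hVopen, hVmem⟩ := eventually_nhds_iff.1 hgood
  have hVsource : V ⊆ e.source := fun q hq ↦ (hV q hq).1
  have hleft : ∀ q ∈ V, e.symm (Θ q) = q := fun q hq ↦ e.left_inv (hVsource hq)
  refine ⟨Θ '' V, e.isOpen_image_of_subset_source hVopen hVsource, ⟨_, hVmem, hΘ₀⟩, ?_,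
    V, hVopen, e.symm, Θ, ?_, mapsTo_image Θ V, ⟨?_, hleft⟩, ?_, ?_, ?_, ?_⟩
  · rintro _ ⟨q, hq, rfl⟩
    exact (hV q hq).2.1
  · rintro _ ⟨q, hq, rfl⟩
    rwa [hleft q hq]
  · rintro _ ⟨q, hq, rfl⟩
    rw [hleft q hq]
  · exact fun q hq ↦ ⟨Θ q, mem_image_of_mem Θ hq, hleft q hq⟩
  · rintro _ ⟨q, hq, rfl⟩
    exact (hV q hq).2.2.2.1.contDiffWithinAt
  · exact fun q hq ↦ (hV q hq).2.2.1.contDiffWithinAt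
  · rintro _ ⟨q, hq, rfl⟩
    obtain ⟨-, -, hΘq, hsymmq, hfield⟩ := hV q hq
    have hcomp := (hsymmq.differentiableAt hr').hasFDerivAt.comp q
      (hΘq.differentiableAt hr').hasFDerivAt
    have hid : (e.symm ∘ Θ) =ᶠ[𝓝 q] id := by
      filter_upwards [hVopen.mem_nhds hq] with y hy using hleft y hy
    have := hcomp.unique ((hasFDerivAt_id q).congr_of_eventuallyEq hid)
    rw [← hfield]
    exact DFunLike.congr_fun this (1, 0)
end
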